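/- arXiv:math/9806077 — 3 statements merged into one kernel-verified Lean document; each statement's English description precedes it below -/
import Mathlib

section
/- Let ω₁, ω₂ be complex numbers that are linearly independent over ℝ (equivalently, ω₂/ω₁ is not real), and let f : ℂ → ℂ be meromorphic on all of ℂ and doubly periodic with respect to the lattice Λ = ℤω₁ + ℤω₂, i.e. f(z+ω₁)=f(z) and f(z+ω₂)=f(z) for all z ∈ ℂ. Then f satisfies an algebraic addition theorem: there exists a nonzero polynomial G in three variables with complex coefficients such that G(f(u+v), f(u), f(v)) = 0 for all u, v ∈ ℂ such that f is analytic at u, at v, and at u+v. -/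
open Metric Filter Topology

lemma aat_factor (U : Set ℂ) (hU : IsOpen U) (T : Finset ℂ) (hTU : ∀ t ∈ T, t ∈ U) :
    ∀ Φ : ℂ → ℂ, DifferentiableOn ℂ Φ U → (∀ t ∈ T, Φ t = 0) →
    ∃ Ψ : ℂ → ℂ, DifferentiableOn ℂ Ψ U ∧ ∀ z, Φ z = (∏ t ∈ T, (z - t)) * Ψ z := by
  classical
  induction T using Finset.induction_on with
  | empty => intro Φ h _; exact ⟨Φ, h, by simp⟩
  | insert t T ht ih =>
    intro Φ h h0
    have htU : t ∈ U := hTU t (by simp)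
    have hd : DifferentiableOn ℂ (dslope Φ t) U :=
      (Complex.differentiableOn_dslope (hU.mem_nhds htU)).2 h
    have hmul : ∀ z, Φ z = (z - t) * dslope Φ t z := by
      intro z
      have := sub_smul_dslope Φ t z
      rw [h0 t (by simp), sub_zero] at this
      simpa using this.symm
    obtain ⟨Ψ, h1, h2⟩ := ih (fun s hs => hTU s (by simp [hs])) (dslope Φ t) hd (by
      intro s hs
      have h3 := hmul s
      rw [h0 s (by simp [hs])] at h3
      have : s - t ≠ 0 := sub_ne_zero.2 (by rintro rfl; exact ht hs)
      simpa [this] using h3.symm)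
    refine ⟨Ψ, h1, fun z => ?_⟩
    rw [hmul, h2, Finset.prod_insert ht, mul_assoc]

lemma aat_schwarz (r B : ℝ) (hr : 0 < r) (T : Finset ℂ) (hT : ∀ t ∈ T, ‖t‖ ≤ 1) (Φ : ℂ → ℂ)
    (hΦ : DifferentiableOn ℂ Φ (ball 0 (2 * r + 4))) (h0 : ∀ t ∈ T, Φ t = 0)
    (hB : ∀ z ∈ ball (0 : ℂ) (2 * r + 4), ‖Φ z‖ ≤ B) :
    ∀ z, ‖z‖ ≤ r → ‖Φ z‖ ≤ B / 2 ^ T.card := by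
  intro z hz
  obtain ⟨Ψ, h1, h2⟩ := aat_factor _ isOpen_ball T
    (fun t ht => by have := hT t ht; simp; linarith) Φ hΦ h0
  have hpos : (0 : ℝ) < (2 * r + 2) ^ T.card := by positivity
  have key : ‖Ψ z‖ ≤ B / (2 * r + 2) ^ T.card := by
    refine Complex.norm_le_of_forall_mem_frontier_norm_le (U := ball 0 (2 * r + 3))
      isBounded_ball ?_ ?_ ?_
    · apply DifferentiableOn.diffContOnCl
      rw [closure_ball _ (by positivity)]
      exact h1.mono (closedBall_subset_ball (by linarith))
    · intro x hx
      rw [frontier_ball _ (by positivity)] at hx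
      have hx' : ‖x‖ = 2 * r + 3 := by simpa using hx
      rw [le_div_iff₀ hpos]
      have hb := hB x (by simp [hx']; linarith)
      rw [h2, norm_mul, norm_prod] at hb
      refine le_trans ?_ hb
      rw [mul_comm]
      gcongr
      rw [← Finset.prod_const]
      apply Finset.prod_le_prod
      · intros; positivity
      · intro t ht
        have := norm_sub_norm_le x t
        have := hT t ht
        linarith
    · apply subset_closure
      simp; linarith
  rw [h2, norm_mul, norm_prod]
  have : ∏ t ∈ T, ‖z - t‖ ≤ (r + 1) ^ T.card := by
    rw [← Finset.prod_const]
    apply Finset.prod_le_prod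
    · intros; positivity
    · intro t ht
      have := norm_sub_le z t
      have := hT t ht
      linarith
  calc _ ≤ (r + 1) ^ T.card * (B / (2 * r + 2) ^ T.card) := by gcongr
    _ = _ := by
      rw [show 2 * r + 2 = 2 * (r + 1) by ring, mul_pow]
      have : r + 1 ≠ 0 := by positivity
      field_simp

lemma aat_core (f : ℂ → ℂ) (A : Set ℂ) (hAo : IsOpen A) (hAd : Dense A) (r : ℝ) (hr : 0 < r)
    (hper : ∀ z : ℂ, ∃ l : ℂ, ‖z + l‖ ≤ r ∧ (∀ x, f (x + l) = f x) ∧ ∀ x ∈ A, x + l ∈ A)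
    (a b : ℂ → ℂ) (ha : DifferentiableOn ℂ a (ball 0 (3 * r + 4)))
    (hb : DifferentiableOn ℂ b (ball 0 (3 * r + 4)))
    (hab : ∀ z ∈ A, z ∈ ball (0 : ℂ) (3 * r + 4) → f z * b z = a z)
    (c C : ℝ) (hc : 0 < c) (hcl : ∀ z ∈ ball (0 : ℂ) (3 * r + 4), c ≤ max ‖a z‖ ‖b z‖)
    (hCl : ∀ z ∈ ball (0 : ℂ) (3 * r + 4), max ‖a z‖ ‖b z‖ ≤ C)
    (N : ℕ) (g : Fin (N + 1) → Fin (N + 1) → ℂ) (w : ℂ) (hw : ‖w‖ ≤ r) (T : Finset ℂ)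
    (hT : ∀ t ∈ T, ‖t‖ ≤ 1)
    (hT0 : ∀ t ∈ T, ∑ i, ∑ k, g i k * (a (t + w) ^ (i : ℕ) * b (t + w) ^ (N - i : ℕ)) *
      (a t ^ (k : ℕ) * b t ^ (N - k : ℕ)) = 0)
    (hTc : 2 * (C * C) ^ N ≤ (c * c) ^ N * 2 ^ T.card) (z : ℂ) (hz : ‖z‖ ≤ r) :
    ∑ i, ∑ k, g i k * (a (z + w) ^ (i : ℕ) * b (z + w) ^ (N - i : ℕ)) *
      (a z ^ (k : ℕ) * b z ^ (N - k : ℕ)) = 0 := by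
  set Φ : ℂ → ℂ := fun z => ∑ i, ∑ k, g i k * (a (z + w) ^ (i : ℕ) * b (z + w) ^ (N - i : ℕ)) *
      (a z ^ (k : ℕ) * b z ^ (N - k : ℕ)) with hΦdef
  change Φ z = 0
  have hmem : ∀ x ∈ ball (0 : ℂ) (2 * r + 4), x ∈ ball (0 : ℂ) (3 * r + 4) ∧
      x + w ∈ ball (0 : ℂ) (3 * r + 4) := by
    intro x hx
    have hx' : ‖x‖ < 2 * r + 4 := by simpa using hx
    have := norm_add_le x w
    constructor <;> simp <;> linarith
  have hΦd : DifferentiableOn ℂ Φ (ball 0 (2 * r + 4)) := by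
    have h1 : DifferentiableOn ℂ (fun x => x + w) (ball 0 (2 * r + 4)) := by fun_prop
    have ha1 := ha.comp h1 (fun x hx => (hmem x hx).2)
    have hb1 := hb.comp h1 (fun x hx => (hmem x hx).2)
    have ha2 := ha.mono (fun x hx => (hmem x hx).1)
    have hb2 := hb.mono (fun x hx => (hmem x hx).1)
    simp only [Function.comp_def] at ha1 hb1
    refine DifferentiableOn.fun_sum fun i _ => DifferentiableOn.fun_sum fun k _ => ?_
    exact (((ha1.fun_pow _).fun_mul (hb1.fun_pow _)).const_mul _).fun_mul
      ((ha2.fun_pow _).fun_mul (hb2.fun_pow _))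
  set H : ℂ → ℝ := fun z => max ‖f z‖ 1 with hH
  have hH1 : ∀ z, 1 ≤ H z := fun z => le_max_right _ _
  have hHf : ∀ z, ‖f z‖ ≤ H z := fun z => le_max_left _ _
  have hbH : ∀ x ∈ A, x ∈ ball (0 : ℂ) (3 * r + 4) → ‖b x‖ * H x = max ‖a x‖ ‖b x‖ := by
    intro x hx hx'
    rw [hH, mul_max_of_nonneg _ _ (norm_nonneg _), ← hab x hx hx', norm_mul, mul_one, mul_comm]
  set W : Set ℂ := A ∩ (fun x => x + w) ⁻¹' A with hWdef
  have hWd : Dense W := by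
    apply hAd.inter_of_isOpen_left _ hAo
    exact hAd.preimage (Homeomorph.addRight w).isOpenMap
  set h : ℂ → ℂ := fun z => ∑ i : Fin (N + 1), ∑ k : Fin (N + 1),
    g i k * f (z + w) ^ (i : ℕ) * f z ^ (k : ℕ) with hh
  have hΦh : ∀ x ∈ W, x ∈ ball (0 : ℂ) (2 * r + 4) → Φ x = (b (x + w) * b x) ^ N * h x := by
    intro x hx hx'
    simp only [hΦdef, hh, Finset.mul_sum]
    refine Finset.sum_congr rfl fun i _ => Finset.sum_congr rfl fun k _ => ?_
    rw [← hab x hx.1 (hmem x hx').1, ← hab (x + w) hx.2 (hmem x hx').2]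
    have e1 : b (x + w) ^ N = b (x + w) ^ (i : ℕ) * b (x + w) ^ (N - i : ℕ) := by
      rw [← pow_add]; congr 1; omega
    have e2 : b x ^ N = b x ^ (k : ℕ) * b x ^ (N - k : ℕ) := by
      rw [← pow_add]; congr 1; omega
    rw [mul_pow (b (x + w)), e1, e2, mul_pow, mul_pow]
    ring
  have hbound : ∀ s : ℝ, 0 ≤ s → (∀ x ∈ W, ‖h x‖ ≤ s * (H (x + w) * H x) ^ N) →
      ∀ x ∈ ball (0 : ℂ) (2 * r + 4), ‖Φ x‖ ≤ s * (C * C) ^ N := by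
    intro s hs hsh
    by_contra! hcon
    obtain ⟨x, hx, hx2⟩ := hcon
    have hop : IsOpen (ball (0 : ℂ) (2 * r + 4) ∩ (fun x => ‖Φ x‖) ⁻¹' Set.Ioi (s * (C * C) ^ N)) :=
      hΦd.continuousOn.norm.isOpen_inter_preimage isOpen_ball isOpen_Ioi
    obtain ⟨y, ⟨hy1, hy2⟩, hyW⟩ := hWd.inter_open_nonempty _ hop ⟨x, hx, hx2⟩
    have hy2' : s * (C * C) ^ N < ‖Φ y‖ := hy2
    refine absurd hy2' (not_lt.2 ?_)
    rw [hΦh y hyW hy1, norm_mul, norm_pow, norm_mul]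
    have m1 := hbH y hyW.1 (hmem y hy1).1
    have m2 := hbH (y + w) hyW.2 (hmem y hy1).2
    have n1 := hCl y (hmem y hy1).1
    have n2 := hCl (y + w) (hmem y hy1).2
    rw [← m1] at n1
    rw [← m2] at n2
    have p1 : 0 ≤ H y := zero_le_one.trans (hH1 _)
    have p2 : 0 ≤ H (y + w) := zero_le_one.trans (hH1 _)
    have pC : 0 ≤ C := le_trans (by positivity) n1
    calc (‖b (y + w)‖ * ‖b y‖) ^ N * ‖h y‖
        ≤ (‖b (y + w)‖ * ‖b y‖) ^ N * (s * (H (y + w) * H y) ^ N) := by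
          gcongr; exact hsh y hyW
      _ = s * ((‖b (y + w)‖ * H (y + w)) * (‖b y‖ * H y)) ^ N := by
          simp only [mul_pow]; ring
      _ ≤ s * (C * C) ^ N := by gcongr
  have hstep : ∀ s : ℝ, 0 ≤ s → (∀ x ∈ W, ‖h x‖ ≤ s * (H (x + w) * H x) ^ N) →
      (∀ x ∈ W, ‖h x‖ ≤ (s / 2) * (H (x + w) * H x) ^ N) := by
    intro s hs hsh x hxW
    have hΦb := aat_schwarz r _ hr T hT Φ hΦd hT0 (hbound s hs hsh)
    obtain ⟨l, hl1, hl2, hl3⟩ := hper x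
    have hyW : x + l ∈ W := ⟨hl3 x hxW.1, by
      change x + l + w ∈ A
      rw [add_right_comm]; exact hl3 _ hxW.2⟩
    have e1 : f (x + l) = f x := hl2 x
    have e2 : f (x + l + w) = f (x + w) := by rw [add_right_comm]; exact hl2 _
    have e3 : h (x + l) = h x := by simp only [hh, e1, e2]
    have e4 : H (x + l) = H x := by simp only [hH, e1]
    have e5 : H (x + l + w) = H (x + w) := by simp only [hH, e2]
    rw [← e3, ← e4, ← e5]
    generalize x + l = y at *
    have hy1 : y ∈ ball (0 : ℂ) (2 * r + 4) := by simp; linarith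
    have q := hΦb y hl1
    rw [hΦh y hyW hy1, norm_mul, norm_pow, norm_mul] at q
    have m1 := hbH y hyW.1 (hmem y hy1).1
    have m2 := hbH (y + w) hyW.2 (hmem y hy1).2
    have n1 := hcl y (hmem y hy1).1
    have n2 := hcl (y + w) (hmem y hy1).2
    rw [← m1] at n1
    rw [← m2] at n2
    have p1 : 0 ≤ H y := zero_le_one.trans (hH1 _)
    have p2 : 0 ≤ H (y + w) := zero_le_one.trans (hH1 _)
    have hcc : 0 < (c * c) ^ N := by positivity
    have hq2 : s * (C * C) ^ N / 2 ^ T.card ≤ s / 2 * (c * c) ^ N := by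
      rw [div_le_iff₀ (by positivity)]
      nlinarith
    have : (c * c) ^ N * ‖h y‖ ≤ (c * c) ^ N * (s / 2 * (H (y + w) * H y) ^ N) :=
      calc (c * c) ^ N * ‖h y‖ ≤ ((‖b (y + w)‖ * H (y + w)) * (‖b y‖ * H y)) ^ N * ‖h y‖ := by
            gcongr
        _ = ((‖b (y + w)‖ * ‖b y‖) ^ N * ‖h y‖) * (H (y + w) * H y) ^ N := by
            simp only [mul_pow]; ring
        _ ≤ (s / 2 * (c * c) ^ N) * (H (y + w) * H y) ^ N := by
            exact mul_le_mul_of_nonneg_right (q.trans hq2) (by positivity)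
        _ = _ := by ring
    exact le_of_mul_le_mul_left this hcc
  have hinit : ∀ x ∈ W, ‖h x‖ ≤ (∑ i, ∑ k, ‖g i k‖) * (H (x + w) * H x) ^ N := by
    intro x _
    simp only [hh, Finset.sum_mul]
    refine norm_sum_le_of_le _ fun i _ => norm_sum_le_of_le _ fun k _ => ?_
    rw [norm_mul, norm_mul, norm_pow, norm_pow, mul_pow, mul_assoc]
    have p1 : 0 ≤ H x := zero_le_one.trans (hH1 _)
    have p2 : 0 ≤ H (x + w) := zero_le_one.trans (hH1 _)
    gcongr
    · exact (pow_le_pow_left₀ (norm_nonneg _) (hHf _) _).trans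
        (pow_le_pow_right₀ (hH1 _) (by omega))
    · exact (pow_le_pow_left₀ (norm_nonneg _) (hHf _) _).trans
        (pow_le_pow_right₀ (hH1 _) (by omega))
  have hs0 : 0 ≤ ∑ i, ∑ k, ‖g i k‖ := by positivity
  generalize (∑ i, ∑ k, ‖g i k‖) = s at hinit hs0
  have hiter : ∀ n : ℕ, ∀ x ∈ W, ‖h x‖ ≤ (s / 2 ^ n) * (H (x + w) * H x) ^ N := by
    intro n
    induction n with
    | zero => simpa using hinit
    | succ n ih =>
      have := hstep _ (by positivity) ih
      intro x hx
      convert this x hx using 2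
      rw [pow_succ]; field_simp
  have hzero : ∀ x ∈ W, ‖h x‖ ≤ 0 * (H (x + w) * H x) ^ N := by
    intro x hx
    have ht : Tendsto (fun n : ℕ => (s / 2 ^ n) * (H (x + w) * H x) ^ N) atTop
        (𝓝 (0 * (H (x + w) * H x) ^ N)) := by
      apply Tendsto.mul_const
      have := (tendsto_pow_atTop_nhds_zero_of_lt_one (r := (1 / 2 : ℝ)) (by norm_num)
        (by norm_num)).const_mul s
      simpa [div_eq_mul_inv] using this
    exact ge_of_tendsto' ht (fun n => hiter n x hx)
  have := hbound 0 le_rfl hzero z (by simp; linarith)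
  simpa using this

lemma aat_extract (f : ℂ → ℂ) (hf : MeromorphicOn f Set.univ) (ρ : ℝ) (hρ : 0 < ρ) :
    ∃ a b : ℂ → ℂ, DifferentiableOn ℂ a (ball 0 ρ) ∧ DifferentiableOn ℂ b (ball 0 ρ) ∧
      (∀ z, AnalyticAt ℂ f z → z ∈ ball (0 : ℂ) ρ → f z * b z = a z) ∧
      ∃ c C : ℝ, 0 < c ∧ (∀ z ∈ ball (0 : ℂ) ρ, c ≤ max ‖a z‖ ‖b z‖) ∧
        (∀ z ∈ ball (0 : ℂ) ρ, max ‖a z‖ ‖b z‖ ≤ C) := by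
  classical
  by_cases htop : ∃ z, meromorphicOrderAt f z = ⊤
  · refine ⟨fun _ => 0, fun _ => 1, by fun_prop, by fun_prop, ?_, 1, 1, one_pos, by simp, by simp⟩
    intro z hz _
    have hzt : meromorphicOrderAt f z = ⊤ := by
      by_contra hne
      obtain ⟨x, hx⟩ := htop
      exact hf.meromorphicOrderAt_ne_top_of_isPreconnected isPreconnected_univ
        (Set.mem_univ z) (Set.mem_univ x) hne hx
    rw [meromorphicOrderAt_eq_top_iff] at hzt
    have := (hz.continuousAt.eventuallyEq_nhds_iff_eventuallyEq_nhdsNE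
      (continuousAt_const (y := (0 : ℂ)))).1 hzt
    simpa using this.eq_of_nhds
  push Not at htop
  set U := closedBall (0 : ℂ) ρ with hU
  have hUc : IsCompact U := isCompact_closedBall _ _
  have hfU : MeromorphicOn f U := hf.mono_set (Set.subset_univ _)
  set D := MeromorphicOn.divisor f U with hD
  have hfin : D.support.Finite := D.finiteSupport hUc
  obtain ⟨g, hg1, hg2, hg3⟩ := hfU.extract_zeros_poles (fun u => htop u) hfin
  rw [← hD] at hg3
  set S := hfin.toFinset with hS
  set p : ℂ → ℂ := fun z => ∏ t ∈ S, (z - t) ^ (D t).toNat with hp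
  set b : ℂ → ℂ := fun z => ∏ t ∈ S, (z - t) ^ (-D t).toNat with hb
  have hpd : Differentiable ℂ p := by
    rw [hp]; fun_prop
  have hbd : Differentiable ℂ b := by
    rw [hb]; fun_prop
  have hgd : ∀ z ∈ U, DifferentiableAt ℂ g z := fun z hz => (hg1 z hz).differentiableAt
  have hsub : ball (0 : ℂ) ρ ⊆ U := ball_subset_closedBall
  have hgon : DifferentiableOn ℂ g U := fun z hz => (hgd z hz).differentiableWithinAt
  have haon : DifferentiableOn ℂ (fun z => p z * g z) U := hpd.differentiableOn.fun_mul hgon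
  refine ⟨fun z => p z * g z, b, haon.mono hsub, hbd.differentiableOn, ?_, ?_⟩
  · intro z hz hzb
    have hzU : U ∈ 𝓝 z := mem_of_superset (isOpen_ball.mem_nhds hzb) hsub
    have h1 : (fun x => f x * b x) =ᶠ[𝓝[≠] z] fun x => p x * g x := by
      have h2 : ∀ᶠ x in 𝓝[≠] z, x ∈ U → f x = ((∏ᶠ u, (· - u) ^ D u) • g) x := by
        have := (mem_codiscreteWithin.1 hg3) z (mem_of_mem_nhds hzU)
        rw [disjoint_principal_right] at this
        filter_upwards [this] with x hx hxU
        by_contra hne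
        exact hx ⟨hxU, hne⟩
      have h3 : ∀ᶠ x in 𝓝[≠] z, x ∉ S := by
        have : (↑(S.erase z) : Set ℂ)ᶜ ∈ 𝓝 z :=
          (S.erase z).finite_toSet.isClosed.isOpen_compl.mem_nhds (by simp)
        filter_upwards [mem_nhdsWithin_of_mem_nhds this, self_mem_nhdsWithin] with x hx hxz hxS
        exact hx (by simpa using And.intro hxS hxz)
      filter_upwards [h2, h3, mem_nhdsWithin_of_mem_nhds hzU] with x hx hxS hxU
      rw [hx hxU, Function.FactorizedRational.finprod_eq_fun hfin]
      have : ∏ᶠ u, (x - u) ^ D u = ∏ u ∈ S, (x - u) ^ D u := by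
        apply finprod_eq_prod_of_mulSupport_subset
        intro u hu
        simp only [hS, Set.Finite.coe_toFinset]
        intro h0
        apply hu
        simp [h0]
      simp only [Pi.smul_apply', smul_eq_mul, this]
      rw [mul_right_comm]
      congr 1
      rw [← Finset.prod_mul_distrib]
      refine Finset.prod_congr rfl fun u hu => ?_
      have hne : x - u ≠ 0 := sub_ne_zero.2 (by rintro rfl; exact hxS hu)
      rw [← zpow_natCast, ← zpow_natCast, ← zpow_add₀ hne]
      congr 1
      omega
    have hc1 : ContinuousAt (fun x => f x * b x) z := hz.continuousAt.mul hbd.continuous.continuousAt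
    have hc2 : ContinuousAt (fun x => p x * g x) z :=
      hpd.continuous.continuousAt.mul (hgd z (hsub hzb)).continuousAt
    exact ((hc1.eventuallyEq_nhds_iff_eventuallyEq_nhdsNE hc2).1 h1).eq_of_nhds
  · have hcont : ContinuousOn (fun z => max ‖p z * g z‖ ‖b z‖) U :=
      haon.continuousOn.norm.sup hbd.continuous.continuousOn.norm
    have hne : U.Nonempty := ⟨0, by simp [hU, hρ.le]⟩
    obtain ⟨x, hx, hxm⟩ := hUc.exists_isMinOn hne hcont
    obtain ⟨y, hy, hym⟩ := hUc.exists_isMaxOn hne hcont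
    refine ⟨_, _, ?_, fun z hz => hxm (hsub hz), fun z hz => hym (hsub hz)⟩
    have hgx : g x ≠ 0 := hg2 ⟨x, hx⟩
    by_contra hle
    rw [not_lt] at hle
    have z1 : p x * g x = 0 := norm_le_zero_iff.1 ((le_max_left _ _).trans hle)
    have z2 : b x = 0 := norm_le_zero_iff.1 ((le_max_right _ _).trans hle)
    have z3 : p x = 0 := by simpa [hgx] using z1
    simp only [hp, hb, Finset.prod_eq_zero_iff] at z2 z3
    obtain ⟨t, _, ht⟩ := z2
    obtain ⟨t', _, ht'⟩ := z3
    obtain ⟨e1, n1⟩ := pow_eq_zero_iff'.1 ht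
    obtain ⟨e2, n2⟩ := pow_eq_zero_iff'.1 ht'
    have : t = t' := by rw [← sub_eq_zero.1 e1, ← sub_eq_zero.1 e2]
    subst this
    omega

lemma aat_period (ω₁ ω₂ : ℂ) (hω : LinearIndependent ℝ ![ω₁, ω₂])
    (f : ℂ → ℂ) (hf₁ : ∀ z : ℂ, f (z + ω₁) = f z) (hf₂ : ∀ z : ℂ, f (z + ω₂) = f z) :
    ∃ r : ℝ, 1 ≤ r ∧ ∀ z : ℂ, ∃ l : ℂ, ‖z + l‖ ≤ r ∧ (∀ x, f (x + l) = f x) ∧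
      ∀ x, AnalyticAt ℂ f x → AnalyticAt ℂ f (x + l) := by
  let B := basisOfLinearIndependentOfCardEqFinrank hω (by simp)
  have hB : ∀ i, B i = ![ω₁, ω₂] i := fun i => by simp [B]
  have hspan : ∀ l ∈ Submodule.span ℤ (Set.range B), ∀ x, f (x + l) = f x := by
    intro l hl
    induction hl using Submodule.span_induction with
    | mem l hl =>
      obtain ⟨i, rfl⟩ := hl
      fin_cases i
      · simpa [hB] using hf₁
      · simpa [hB] using hf₂
    | zero => simp
    | add x y _ _ hx hy => intro z; rw [← add_assoc, hy, hx]
    | smul n x _ hx =>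
      have hp : Function.Periodic f x := hx
      exact hp.zsmul n
  refine ⟨∑ i, ‖B i‖ + 1, le_add_of_nonneg_left (by positivity), fun z => ⟨-(ZSpan.floor B z : ℂ), ?_, ?_, ?_⟩⟩
  · have := ZSpan.norm_fract_le B z
    rw [ZSpan.fract_apply] at this
    rw [← sub_eq_add_neg]; linarith
  · exact hspan _ (Submodule.neg_mem _ (ZSpan.floor B z).2)
  · intro x hx
    have h2 : ∀ y, f (y + (ZSpan.floor B z : ℂ)) = f y := hspan _ (ZSpan.floor B z).2
    generalize (ZSpan.floor B z : ℂ) = m at h2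
    have : AnalyticAt ℂ (fun y => f (y + m)) (x + -m) := by
      apply AnalyticAt.fun_comp (g := f) (f := fun y => y + m)
      · simpa using hx
      · fun_prop
    simpa only [h2] using this

/-- Weierstrass's algebraic addition theorem, case n = 1: any elliptic
function (meromorphic on ℂ and doubly periodic with respect to a lattice
ℤω₁ + ℤω₂, ω₁, ω₂ linearly independent over ℝ) satisfies an algebraic
addition theorem. -/
theorem elliptic_algebraic_addition_theorem
    (ω₁ ω₂ : ℂ) (hω : LinearIndependent ℝ ![ω₁, ω₂])
    (f : ℂ → ℂ) (hf : MeromorphicOn f Set.univ)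
    (hf₁ : ∀ z : ℂ, f (z + ω₁) = f z) (hf₂ : ∀ z : ℂ, f (z + ω₂) = f z) :
    ∃ G : MvPolynomial (Fin 3) ℂ, G ≠ 0 ∧
      ∀ u v : ℂ, AnalyticAt ℂ f u → AnalyticAt ℂ f v → AnalyticAt ℂ f (u + v) →
        MvPolynomial.eval ![f (u + v), f u, f v] G = 0 := by
  classical
  obtain ⟨r, hr1, hper⟩ := aat_period ω₁ ω₂ hω f hf₁ hf₂
  have hr : 0 < r := by linarith
  obtain ⟨a, b, ha, hb, hab, c, C, hc, hcl, hCl⟩ := aat_extract f hf (3 * r + 4) (by positivity)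
  set A : Set ℂ := {z | AnalyticAt ℂ f z} with hA
  have hAo : IsOpen A := isOpen_analyticAt ℂ f
  have hAd : Dense A := by
    intro x
    rw [mem_closure_iff_frequently]
    exact ((hf x (Set.mem_univ x)).eventually_analyticAt.frequently).filter_mono nhdsWithin_le_nhds
  obtain ⟨L, hL⟩ := pow_unbounded_of_one_lt (C * C / (c * c)) (one_lt_two (α := ℝ))
  set N : ℕ := (L + 1) ^ 2 with hN
  have hCc : 2 * (C * C) ^ N ≤ (c * c) ^ N * 2 ^ (L * N + 1) := by
    have h1 : C * C ≤ (c * c) * 2 ^ L := by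
      rw [div_lt_iff₀ (by positivity)] at hL
      linarith
    have h2 := pow_le_pow_left₀ (mul_self_nonneg C) h1 N
    rw [mul_pow (c * c), ← pow_mul] at h2
    rw [pow_succ]; linarith
  obtain ⟨T, hTs, hTcard⟩ := (infinite_of_mem_nhds (0 : ℂ)
    (closedBall_mem_nhds (0 : ℂ) one_pos)).exists_subset_card_eq (L * N + 1)
  have hT : ∀ t ∈ T, ‖t‖ ≤ 1 := fun t ht => by simpa using hTs ht
  rw [← hTcard] at hCc
  set β : Fin (N + 1) → ℂ → ℂ := fun i z => a z ^ (i : ℕ) * b z ^ (N - i : ℕ) with hβ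
  let Lm : (Fin (N + 1) × Fin (N + 1) × Fin (N + 1) → ℂ) →ₗ[ℂ] (T × T → ℂ) :=
    { toFun := fun g q => ∑ i, ∑ j, ∑ k,
        g (i, j, k) * β i (q.1 + q.2) * β j q.1 * β k q.2
      map_add' := by
        intro g g'
        ext q
        simp [add_mul, Finset.sum_add_distrib]
      map_smul' := by
        intro s g
        ext q
        simp [Finset.mul_sum, mul_assoc] }
  have hker : LinearMap.ker Lm ≠ ⊥ := by
    apply LinearMap.ker_ne_bot_of_finrank_lt
    simp only [Module.finrank_fintype_fun_eq_card, Fintype.card_prod, Fintype.card_fin,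
      Fintype.card_coe, hTcard]
    have h1 : L * N + 1 ≤ (L + 1) * (N + 1) := by nlinarith
    calc (L * N + 1) * (L * N + 1) ≤ ((L + 1) * (N + 1)) * ((L + 1) * (N + 1)) :=
          Nat.mul_le_mul h1 h1
      _ = N * ((N + 1) * (N + 1)) := by rw [hN]; ring
      _ < (N + 1) * ((N + 1) * (N + 1)) := by
          apply Nat.mul_lt_mul_of_pos_right (by omega) (by positivity)
  obtain ⟨g, hg, hg0⟩ := Submodule.exists_mem_ne_zero_of_ne_bot hker
  have hgT : ∀ u ∈ T, ∀ v ∈ T, ∑ i, ∑ j, ∑ k,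
      g (i, j, k) * β i (u + v) * β j u * β k v = 0 := by
    intro u hu v hv
    exact congrFun (LinearMap.mem_ker.1 hg) (⟨u, hu⟩, ⟨v, hv⟩)
  -- step 1 : the first variable in `T`
  have core := aat_core f A hAo hAd r hr hper a b ha hb hab c C hc hcl hCl N
  have s1 : ∀ u ∈ T, ‖u‖ ≤ r → ∀ v, ‖v‖ ≤ r → ∑ i, ∑ j, ∑ k,
      g (i, j, k) * β i (u + v) * β j u * β k v = 0 := by
    intro u hu hur v hv
    have e : ∀ v, ∑ i, ∑ j, ∑ k, g (i, j, k) * β i (u + v) * β j u * β k v =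
        ∑ i, ∑ k, (∑ j, g (i, j, k) * β j u) * β i (v + u) * β k v := by
      intro v
      refine Finset.sum_congr rfl fun i _ => ?_
      rw [Finset.sum_comm]
      refine Finset.sum_congr rfl fun k _ => ?_
      rw [Finset.sum_mul, Finset.sum_mul]
      refine Finset.sum_congr rfl fun j _ => ?_
      rw [add_comm u v]; ring
    rw [e]
    exact core (fun i k => ∑ j, g (i, j, k) * β j u) u hur T hT
      (fun t ht => by have := hgT u hu t ht; rw [e] at this; exact this) hCc v hv
  have s2 : ∀ u, ‖u‖ ≤ r → ∀ v, ‖v‖ ≤ r → ∑ i, ∑ j, ∑ k,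
      g (i, j, k) * β i (u + v) * β j u * β k v = 0 := by
    intro u hu v hv
    have e : ∀ u, ∑ i, ∑ j, ∑ k, g (i, j, k) * β i (u + v) * β j u * β k v =
        ∑ i, ∑ j, (∑ k, g (i, j, k) * β k v) * β i (u + v) * β j u := by
      intro u
      refine Finset.sum_congr rfl fun i _ => Finset.sum_congr rfl fun j _ => ?_
      rw [Finset.sum_mul, Finset.sum_mul]
      refine Finset.sum_congr rfl fun k _ => ?_
      ring
    rw [e]
    exact core (fun i j => ∑ k, g (i, j, k) * β k v) v hv T hT
      (fun t ht => by have := s1 t ht ((hT t ht).trans hr1) v hv; rw [e] at this; exact this) hCc u hu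
  let m : Fin (N + 1) × Fin (N + 1) × Fin (N + 1) → (Fin 3 →₀ ℕ) := fun q =>
    Finsupp.equivFunOnFinite.symm ![(q.1 : ℕ), (q.2.1 : ℕ), (q.2.2 : ℕ)]
  have hm : Function.Injective m := by
    rintro ⟨i, j, k⟩ ⟨i', j', k'⟩ h
    have h' := Finsupp.equivFunOnFinite.symm.injective h
    have h0 := congrFun h' 0
    have h1 := congrFun h' 1
    have h2 := congrFun h' 2
    simp at h0 h1 h2
    simp [Fin.ext_iff, h0, h1, h2]
  refine ⟨∑ q, MvPolynomial.monomial (m q) (g q), ?_, ?_⟩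
  · intro h0
    apply hg0
    ext q
    have := congrArg (MvPolynomial.coeff (m q)) h0
    simpa [MvPolynomial.coeff_sum, MvPolynomial.coeff_monomial, hm.eq_iff] using this
  · intro u v hu hv huv
    obtain ⟨l, hl1, hl2, hl3⟩ := hper u
    obtain ⟨l', hl1', hl2', hl3'⟩ := hper v
    have hadd : u + l + (v + l') = u + v + l + l' := by ring
    have e1 : f (u + l + (v + l')) = f (u + v) := by rw [hadd, hl2', hl2]
    have hz := s2 _ hl1 _ hl1'
    have k1 : AnalyticAt ℂ f (u + l) := hl3 _ hu
    have k2 : AnalyticAt ℂ f (v + l') := hl3' _ hv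
    have k3 : AnalyticAt ℂ f (u + l + (v + l')) := by rw [hadd]; exact hl3' _ (hl3 _ huv)
    rw [← e1, ← hl2 u, ← hl2' v]
    generalize u + l = x at *
    generalize v + l' = y at *
    have hbx : ∀ z, AnalyticAt ℂ f z → ‖z‖ < 3 * r + 4 → b z ≠ 0 ∧
        ∀ i : Fin (N + 1), β i z = b z ^ N * f z ^ (i : ℕ) := by
      intro z hz hzr
      have hzb : z ∈ ball (0 : ℂ) (3 * r + 4) := by simpa using hzr
      have h1 := hab z hz hzb
      constructor
      · intro h0
        have := hcl z hzb
        rw [← h1, h0] at this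
        simp at this
        linarith
      · intro i
        have e1 : b z ^ N = b z ^ (i : ℕ) * b z ^ (N - i : ℕ) := by
          rw [← pow_add]; congr 1; omega
        simp only [hβ]
        rw [← h1, e1]; ring
    have hxy := norm_add_le x y
    obtain ⟨n1, q1⟩ := hbx x k1 (by linarith)
    obtain ⟨n2, q2⟩ := hbx y k2 (by linarith)
    obtain ⟨n3, q3⟩ := hbx (x + y) k3 (by linarith)
    have hprod : (b (x + y) ^ N * b x ^ N * b y ^ N) *
        (∑ i : Fin (N + 1), ∑ j : Fin (N + 1), ∑ k : Fin (N + 1),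
          g (i, j, k) * (f (x + y) ^ (i : ℕ) * f x ^ (j : ℕ) * f y ^ (k : ℕ))) = 0 := by
      rw [← hz]
      simp only [Finset.mul_sum]
      refine Finset.sum_congr rfl fun i _ => Finset.sum_congr rfl fun j _ =>
        Finset.sum_congr rfl fun k _ => ?_
      rw [q1, q2, q3]; ring
    have hne : b (x + y) ^ N * b x ^ N * b y ^ N ≠ 0 := by
      simp [n1, n2, n3]
    have hsum := (mul_eq_zero.1 hprod).resolve_left hne
    rw [← hsum, map_sum]
    simp only [Fintype.sum_prod_type]
    refine Finset.sum_congr rfl fun i _ => Finset.sum_congr rfl fun j _ =>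
        Finset.sum_congr rfl fun k _ => ?_
    rw [MvPolynomial.eval_monomial, Finsupp.prod_fintype _ _ (by simp)]
    simp [m, Fin.prod_univ_three]
end

section
/- Let ω₁, ω₂ be complex numbers that are linearly independent over ℝ, and let f : ℂ → ℂ be meromorphic on all of ℂ and doubly periodic with respect to the lattice Λ = ℤω₁ + ℤω₂. Then for every fixed a ∈ ℂ, the function f and its translate u ↦ f(u + a) are algebraically dependent: there exists a nonzero polynomial Q in two variables with complex coefficients (depending on a) such that Q(f(u + a), f(u)) = 0 for every u ∈ ℂ at which f is analytic and f is analytic at u + a. -/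
open Filter Topology


theorem aux_liouville {h : ℂ → ℂ} {C : ℝ}
    (hd : ∀ z, ∀ᶠ w in 𝓝[≠] z, AnalyticAt ℂ h w)
    (hb : ∀ z, ∀ᶠ w in 𝓝[≠] z, ‖h w‖ ≤ C) :
    ∃ c, ∀ u, AnalyticAt ℂ h u → h u = c := by
  set H : ℂ → ℂ := fun z => limUnder (𝓝[≠] z) h with hH
  have hlim : ∀ z, Tendsto h (𝓝[≠] z) (𝓝 (H z)) := by
    intro z
    apply Complex.tendsto_limUnder_of_differentiable_on_punctured_nhds_of_bounded_under
    · exact (hd z).mono fun w hw => hw.differentiableAt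
    · refine ⟨C + ‖h z‖, ?_⟩
      rw [eventually_map]
      filter_upwards [hb z] with w hw
      exact (norm_sub_le _ _).trans (by linarith)
  have heq : ∀ u, AnalyticAt ℂ h u → H u = h u := by
    intro u hu
    exact tendsto_nhds_unique (hlim u) (hu.continuousAt.tendsto.mono_left nhdsWithin_le_nhds)
  have hHa : ∀ z, AnalyticAt ℂ H z := by
    intro z
    apply Complex.analyticAt_of_differentiable_on_punctured_nhds_of_continuousAt
    · filter_upwards [hd z] with w hw
      have : H =ᶠ[𝓝 w] h := hw.eventually_analyticAt.mono fun v hv => heq v hv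
      exact (hw.congr this.symm).differentiableAt
    · rw [← continuousWithinAt_compl_self]
      refine (hlim z).congr' ?_
      filter_upwards [hd z] with w hw using (heq w hw).symm
  have hHb : ∀ z, ‖H z‖ ≤ C := fun z => le_of_tendsto (hlim z).norm (hb z)
  have hdiff : Differentiable ℂ H := fun z => (hHa z).differentiableAt
  refine ⟨H 0, fun u hu => ?_⟩
  rw [← heq u hu]
  refine hdiff.apply_eq_apply_of_bounded ?_ _ _
  rw [isBounded_iff_forall_norm_le]
  exact ⟨C, by rintro _ ⟨z, rfl⟩; exact hHb z⟩

theorem aux_bdd {h E : ℂ → ℂ} {p : ℂ} {M : ℕ} (hE : AnalyticAt ℂ E p)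
    (h0 : ∀ k < M, iteratedDeriv k E p = 0) (hEh : ∀ z, E z = (z - p) ^ M * h z) :
    ∃ C, ∀ᶠ w in 𝓝[≠] p, ‖h w‖ ≤ C := by
  obtain ⟨G, hG, hEG⟩ := (natCast_le_analyticOrderAt hE).1
    ((natCast_le_analyticOrderAt_iff_iteratedDeriv_eq_zero hE).2 h0)
  refine ⟨‖G p‖ + 1, ?_⟩
  have h1 : ∀ᶠ w in 𝓝 p, ‖G w‖ < ‖G p‖ + 1 :=
    hG.continuousAt.norm.eventually_lt continuousAt_const (by linarith)
  filter_upwards [nhdsWithin_le_nhds hEG, nhdsWithin_le_nhds h1, self_mem_nhdsWithin] with w a b c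
  have : (w - p) ^ M ≠ 0 := pow_ne_zero _ (sub_ne_zero.2 c)
  rw [hEh w, smul_eq_mul] at a
  rw [mul_left_cancel₀ this a]
  exact b.le

theorem aux_lattice {ω₁ ω₂ : ℂ} (hω : LinearIndependent ℝ ![ω₁, ω₂]) :
    ∃ K : Set ℂ, IsCompact K ∧ ∀ z, ∃ q ∈ K, ∃ m n : ℤ, z = q + m * ω₁ + n * ω₂ := by
  refine ⟨(fun s : ℝ × ℝ => (s.1 : ℂ) * ω₁ + s.2 * ω₂) '' (Set.Icc 0 1 ×ˢ Set.Icc 0 1),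
    (isCompact_Icc.prod isCompact_Icc).image (by fun_prop), fun z => ?_⟩
  let b := basisOfLinearIndependentOfCardEqFinrank hω (by simp)
  have hz := b.sum_repr z
  simp only [b, Fin.sum_univ_two, coe_basisOfLinearIndependentOfCardEqFinrank] at hz
  set s := b.repr z 0
  set t := b.repr z 1
  simp only [Matrix.cons_val_zero, Matrix.cons_val_one, Complex.real_smul] at hz
  refine ⟨_, ⟨(Int.fract s, Int.fract t), ⟨⟨Int.fract_nonneg _, (Int.fract_lt_one _).le⟩,
    ⟨Int.fract_nonneg _, (Int.fract_lt_one _).le⟩⟩, rfl⟩, ⌊s⌋, ⌊t⌋, ?_⟩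
  simp only [Int.fract]
  push_cast
  rw [← hz]; ring

theorem aux_compact_bdd {K : Set ℂ} (hK : IsCompact K) {h : ℂ → ℂ}
    (hb : ∀ q ∈ K, ∃ C : ℝ, ∀ᶠ w in 𝓝[≠] q, ‖h w‖ ≤ C) :
    ∃ C : ℝ, ∀ q ∈ K, ∀ᶠ w in 𝓝[≠] q, ‖h w‖ ≤ C := by
  refine hK.induction_on (p := fun s => ∃ C : ℝ, ∀ q ∈ s, ∀ᶠ w in 𝓝[≠] q, ‖h w‖ ≤ C)
    ⟨0, by simp⟩ ?_ ?_ ?_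
  · rintro s t hst ⟨C, hC⟩
    exact ⟨C, fun q hq => hC q (hst hq)⟩
  · rintro s t ⟨C, hC⟩ ⟨D, hD⟩
    refine ⟨max C D, ?_⟩
    rintro q (hq | hq)
    · exact (hC q hq).mono fun w hw => hw.trans (le_max_left _ _)
    · exact (hD q hq).mono fun w hw => hw.trans (le_max_right _ _)
  · intro q hq
    obtain ⟨C, hC⟩ := hb q hq
    have h2 : ∀ᶠ v in 𝓝 q, ∀ᶠ w in 𝓝[≠] v, ‖h w‖ ≤ C := by
      rw [eventually_nhdsWithin_iff] at hC
      filter_upwards [hC.eventually_nhds] with v hv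
      by_cases hvq : v = q
      · subst hvq
        rw [eventually_nhdsWithin_iff]; exact hv
      · have : ∀ᶠ w in 𝓝 v, w ≠ q := isOpen_ne.mem_nhds hvq
        filter_upwards [nhdsWithin_le_nhds hv, nhdsWithin_le_nhds this] with w h1 h3
        exact h1 h3
    exact ⟨_, nhdsWithin_le_nhds h2, C, fun v hv => hv⟩

theorem aux_translate {h : ℂ → ℂ} {C : ℝ} {q l : ℂ} (hl : Function.Periodic h l)
    (hq : ∀ᶠ w in 𝓝[≠] q, ‖h w‖ ≤ C) : ∀ᶠ w in 𝓝[≠] (q + l), ‖h w‖ ≤ C := by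
  have ht : Tendsto (fun w => w - l) (𝓝[≠] (q + l)) (𝓝[≠] q) := by
    refine tendsto_nhdsWithin_iff.2 ⟨?_, ?_⟩
    · have : Tendsto (fun w : ℂ => w - l) (𝓝 (q + l)) (𝓝 (q + l - l)) :=
        (continuous_id.sub continuous_const).tendsto _
      rw [add_sub_cancel_right] at this
      exact this.mono_left nhdsWithin_le_nhds
    · filter_upwards [self_mem_nhdsWithin] with w hw h'
      exact hw (by rw [Set.mem_singleton_iff] at *; rw [← h']; ring)
  filter_upwards [ht.eventually hq] with w hw
  rwa [hl.sub_eq] at hw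

theorem aux_common {f g : ℂ → ℂ} {p : ℂ} (hf : MeromorphicAt f p) (hg : MeromorphicAt g p) :
    ∃ N : ℕ, AnalyticAt ℂ (fun z => (z - p) ^ N * f z) p ∧
      AnalyticAt ℂ (fun z => (z - p) ^ N * g z) p := by
  obtain ⟨m, hm⟩ := hf
  obtain ⟨n, hn⟩ := hg
  refine ⟨n + m, ?_, ?_⟩
  · have : AnalyticAt ℂ (fun z => (z - p) ^ n * ((z - p) ^ m • f z)) p := by fun_prop
    simpa only [pow_add, smul_eq_mul, mul_assoc] using this
  · have : AnalyticAt ℂ (fun z => (z - p) ^ m * ((z - p) ^ n • g z)) p := by fun_prop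
    simpa only [add_comm n m, pow_add, smul_eq_mul, mul_assoc] using this

theorem aux_main {ω₁ ω₂ : ℂ} (hω : LinearIndependent ℝ ![ω₁, ω₂])
    {f g : ℂ → ℂ} (hf : ∀ z, MeromorphicAt f z) (hg : ∀ z, MeromorphicAt g z)
    (hf₁ : Function.Periodic f ω₁) (hf₂ : Function.Periodic f ω₂)
    (hg₁ : Function.Periodic g ω₁) (hg₂ : Function.Periodic g ω₂) :
    ∃ (n : ℕ) (c : Fin (n + 1) × Fin (n + 1) → ℂ), c ≠ 0 ∧
      ∀ u, AnalyticAt ℂ f u → AnalyticAt ℂ g u →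
        ∑ x, c x * (g u ^ (x.1 : ℕ) * f u ^ (x.2 : ℕ)) = 0 := by
  obtain ⟨K, hK, hKz⟩ := aux_lattice hω
  have han : ∀ z, ∀ᶠ w in 𝓝[≠] z, AnalyticAt ℂ f w ∧ AnalyticAt ℂ g w := fun z =>
    (hf z).eventually_analyticAt.and (hg z).eventually_analyticAt
  obtain ⟨z0, hz0f, hz0g⟩ := (han 0).exists
  choose N hNf hNg using fun p => aux_common (hf p) (hg p)
  obtain ⟨S, -, hS⟩ := hK.elim_nhds_subcover
    (fun p => {w | w ∈ ({p}ᶜ : Set ℂ) → AnalyticAt ℂ f w ∧ AnalyticAt ℂ g w})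
    (fun p _ => eventually_nhdsWithin_iff.1 (han p))
  set T := ∑ p : S, N p with hT
  set n := 2 * T + 1 with hn
  let A : ℂ → Fin (n + 1) × Fin (n + 1) → ℂ → ℂ := fun p x z =>
    ((z - p) ^ N p * g z) ^ (x.1 : ℕ) * ((z - p) ^ N p * f z) ^ (x.2 : ℕ) *
      (z - p) ^ (N p * (2 * n - x.1 - x.2))
  have hA : ∀ p x, AnalyticAt ℂ (A p x) p := by
    intro p x
    have h1 := hNf p
    have h2 := hNg p
    exact ((h2.pow _).mul (h1.pow _)).mul (by fun_prop)
  have hAeq : ∀ p x z, A p x z =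
      (z - p) ^ (N p * (2 * n)) * (g z ^ (x.1 : ℕ) * f z ^ (x.2 : ℕ)) := by
    intro p x z
    have e : N p * (2 * n) = N p * x.1 + N p * x.2 + N p * (2 * n - x.1 - x.2) := by
      rw [← mul_add, ← mul_add]
      congr 1
      have := x.1.2
      have := x.2.2
      omega
    simp only [A]
    rw [e, pow_add, pow_add, mul_pow, mul_pow, ← pow_mul, ← pow_mul]
    ring
  let R := Option (Σ p : S, Fin (N p * (2 * n)))
  let M : Matrix R (Fin (n + 1) × Fin (n + 1)) ℂ := fun r x =>
    match r with
    | none => g z0 ^ (x.1 : ℕ) * f z0 ^ (x.2 : ℕ)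
    | some ⟨p, k⟩ => iteratedDeriv k (A p x) p
  have hker : M.mulVecLin.ker ≠ ⊥ := by
    apply LinearMap.ker_ne_bot_of_finrank_lt
    simp only [Module.finrank_fintype_fun_eq_card, R, Fintype.card_option, Fintype.card_sigma,
      Fintype.card_fin, Fintype.card_prod, ← Finset.sum_mul]
    rw [← hT, hn]
    nlinarith
  obtain ⟨c, hc, hc0⟩ := (Submodule.ne_bot_iff _).1 hker
  refine ⟨n, c, hc0, ?_⟩
  have hMc : ∀ r, ∑ x, M r x * c x = 0 := fun r => congrFun (LinearMap.mem_ker.1 hc) r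
  set h : ℂ → ℂ := fun u => ∑ x, c x * (g u ^ (x.1 : ℕ) * f u ^ (x.2 : ℕ)) with hh
  have hha : ∀ u, AnalyticAt ℂ f u → AnalyticAt ℂ g u → AnalyticAt ℂ h u := by
    intro u h1 h2
    refine Finset.analyticAt_fun_sum _ fun x _ => ?_
    exact analyticAt_const.mul ((h2.pow _).mul (h1.pow _))
  have hhp : ∀ l, Function.Periodic f l → Function.Periodic g l → Function.Periodic h l := by
    intro l h1 h2 z
    simp only [hh, h1 z, h2 z]
  have hloc : ∀ q ∈ K, ∃ C : ℝ, ∀ᶠ w in 𝓝[≠] q, ‖h w‖ ≤ C := by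
    intro q hq
    by_cases hqS : q ∈ S
    · refine aux_bdd (E := fun z => ∑ x, c x * A q x z) (M := N q * (2 * n)) ?_ ?_ ?_
      · exact Finset.analyticAt_fun_sum _ fun x _ => analyticAt_const.mul (hA q x)
      · intro k hk
        rw [iteratedDeriv_fun_sum]
        · have := hMc (some ⟨⟨q, hqS⟩, ⟨k, hk⟩⟩)
          simp only [M] at this
          rw [← this]
          refine Finset.sum_congr rfl fun x _ => ?_
          rw [iteratedDeriv_const_mul_field, mul_comm]
        · intro x _
          exact (analyticAt_const.mul (hA q x)).contDiffAt
      · intro z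
        simp only [hAeq, hh, Finset.mul_sum]
        refine Finset.sum_congr rfl fun x _ => ?_
        ring
    · obtain ⟨p, hp, hqp⟩ := Set.mem_iUnion₂.1 (hS hq)
      have hne : q ≠ p := fun e => hqS (e ▸ hp)
      obtain ⟨h1, h2⟩ := hqp hne
      refine ⟨‖h q‖ + 1, ?_⟩
      have h3 : ∀ᶠ w in 𝓝 q, ‖h w‖ < ‖h q‖ + 1 :=
        (hha q h1 h2).continuousAt.norm.eventually_lt continuousAt_const (by linarith)
      exact nhdsWithin_le_nhds (h3.mono fun w hw => hw.le)
  obtain ⟨C, hC⟩ := aux_compact_bdd hK hloc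
  obtain ⟨d, hd⟩ := aux_liouville (h := h) (C := C)
    (fun z => (han z).mono fun w hw => hha w hw.1 hw.2) (fun z => by
      obtain ⟨q, hq, m, k, rfl⟩ := hKz z
      refine aux_translate ((hhp _ hf₂ hg₂).int_mul k) ?_
      exact aux_translate ((hhp _ hf₁ hg₁).int_mul m) (hC q hq))
  have hd0 : d = 0 := by
    rw [← hd z0 (hha z0 hz0f hz0g), ← hMc none]
    refine Finset.sum_congr rfl fun x _ => ?_
    simp only [M]
    ring
  intro u h1 h2
  rw [← hd0]
  exact hd u (hha u h1 h2)

/-- An elliptic function and any of its translates are algebraically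
dependent (specialization of Weierstrass–Thimm–Siegel with the second
variable frozen at a). -/
theorem elliptic_translate_algebraically_dependent
    (ω₁ ω₂ : ℂ) (hω : LinearIndependent ℝ ![ω₁, ω₂])
    (f : ℂ → ℂ) (hf : MeromorphicOn f Set.univ)
    (hf₁ : ∀ z : ℂ, f (z + ω₁) = f z) (hf₂ : ∀ z : ℂ, f (z + ω₂) = f z)
    (a : ℂ) :
    ∃ Q : MvPolynomial (Fin 2) ℂ, Q ≠ 0 ∧
      ∀ u : ℂ, AnalyticAt ℂ f u → AnalyticAt ℂ f (u + a) →
        MvPolynomial.eval ![f (u + a), f u] Q = 0 := by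
  have hfm : ∀ z, MeromorphicAt f z := fun z => hf z (Set.mem_univ z)
  have hgm : ∀ z, MeromorphicAt (fun u => f (u + a)) z := fun z =>
    (hfm (z + a)).comp_analyticAt (f := f) (g := fun u => u + a) (by fun_prop)
  obtain ⟨n, c, hc, h⟩ := aux_main hω hfm hgm hf₁ hf₂
    (fun z => by rw [add_right_comm, hf₁]) (fun z => by rw [add_right_comm, hf₂])
  let e : Fin (n + 1) × Fin (n + 1) → (Fin 2 →₀ ℕ) := fun x =>
    Finsupp.single 0 (x.1 : ℕ) + Finsupp.single 1 (x.2 : ℕ)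
  have he : Function.Injective e := by
    intro x y hxy
    have h0 := DFunLike.congr_fun hxy 0
    have h1 := DFunLike.congr_fun hxy 1
    simp [e] at h0 h1
    ext
    · exact h0
    · exact h1
  refine ⟨∑ x, MvPolynomial.monomial (e x) (c x), ?_, ?_⟩
  · intro hQ
    apply hc
    funext y
    have := congrArg (MvPolynomial.coeff (e y)) hQ
    simpa [MvPolynomial.coeff_sum, MvPolynomial.coeff_monomial, he.eq_iff] using this
  · intro u hu hua
    have hg : AnalyticAt ℂ (fun u => f (u + a)) u :=
      AnalyticAt.fun_comp (f := fun u => u + a) hua (by fun_prop)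
    rw [← h u hu hg, map_sum]
    refine Finset.sum_congr rfl fun x _ => ?_
    simp [e, MvPolynomial.eval_monomial, Finsupp.prod_fintype, Fin.prod_univ_two]
end

section
/- Let ω₁, ω₂ be complex numbers that are linearly independent over ℝ, and let f : ℂ → ℂ be meromorphic on all of ℂ and doubly periodic with respect to the lattice Λ = ℤω₁ + ℤω₂. Then the three functions F, G, H : ℂ × ℂ → ℂ defined by F(u,v) = f(u+v), G(u,v) = f(u), H(u,v) = f(v) are algebraically dependent: there exists a nonzero polynomial Q in three variables with complex coefficients such that Q(f(u+v), f(u), f(v)) = 0 for all pairs (u,v) ∈ ℂ × ℂ such that f is analytic at u, at v, and at u+v. -/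
open Filter Topology

theorem ell_ident (g : ℂ → ℂ) (hg : MeromorphicOn g Set.univ) (z0 : ℂ)
    (h : ∃ᶠ z in 𝓝[≠] z0, g z = 0) (w : ℂ) (hw : ContinuousAt g w) : g w = 0 := by
  have h0 : meromorphicOrderAt g z0 = ⊤ := by
    by_contra hne
    have := (meromorphicOrderAt_ne_top_iff_eventually_ne_zero (hg z0 trivial)).1 hne
    exact h this
  have h1 : meromorphicOrderAt g w = ⊤ := by
    by_contra hne
    exact hg.meromorphicOrderAt_ne_top_of_isPreconnected (x := w) (y := z0)
      isPreconnected_univ trivial trivial hne h0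
  rw [meromorphicOrderAt_eq_top_iff] at h1
  have h2 : Tendsto g (𝓝[≠] w) (𝓝 (g w)) := hw.tendsto.mono_left nhdsWithin_le_nhds
  have h3 : Tendsto g (𝓝[≠] w) (𝓝 0) :=
    tendsto_const_nhds.congr' (h1.mono fun z hz => hz.symm)
  exact tendsto_nhds_unique h2 h3

theorem ell_principal {ι : Type*} [Fintype ι] (φ : ι → ℂ → ℂ) (p : ℂ) (n : ℕ)
    (hm : ∀ i, MeromorphicAt (φ i) p)
    (ho : ∀ i, ((-(n:ℤ) : ℤ) : WithTop ℤ) ≤ meromorphicOrderAt (φ i) p) :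
    ∃ L : (ι → ℂ) →ₗ[ℂ] (Fin n → ℂ), ∀ c, L c = 0 →
      0 ≤ meromorphicOrderAt (fun z => ∑ i, c i * φ i z) p := by
  have key : ∀ i, ∃ h : ℂ → ℂ, AnalyticAt ℂ h p ∧ (fun z => (z - p) ^ n * φ i z) =ᶠ[𝓝[≠] p] h := by
    intro i
    have m1 : MeromorphicAt (fun z => (z - p) ^ n) p := by fun_prop
    have m2 : MeromorphicAt (fun z => (z - p) ^ n * φ i z) p := m1.mul (hm i)
    have h0 : 0 ≤ meromorphicOrderAt (fun z => (z - p) ^ n * φ i z) p := by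
      rw [fun_meromorphicOrderAt_mul m1 (hm i), fun_meromorphicOrderAt_pow_id_sub_const]
      calc (0 : WithTop ℤ) = ((n : ℤ) : WithTop ℤ) + ((-(n:ℤ) : ℤ) : WithTop ℤ) := by
            rw [← WithTop.coe_add]; simp
        _ ≤ _ := by
            gcongr
            · simp
            · exact ho i
    exact ⟨_, (m2.meromorphicOrderAt_nonneg_iff_analyticAt_toMeromorphicNFAt).1 h0,
      m2.eq_nhdsNE_toMeromorphicNFAt⟩
  choose h ha he using key
  refine ⟨⟨⟨fun c k => ∑ i, c i * iteratedDeriv k (h i) p, ?_⟩, ?_⟩, ?_⟩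
  · intro c d; ext k; simp [add_mul, Finset.sum_add_distrib]
  · intro c d; ext k; simp [mul_assoc, Finset.mul_sum]
  · intro c hc
    have hA : AnalyticAt ℂ (fun z => ∑ i, c i * h i z) p := by fun_prop
    have hord : (n : ℕ∞) ≤ analyticOrderAt (fun z => ∑ i, c i * h i z) p := by
      rw [natCast_le_analyticOrderAt_iff_iteratedDeriv_eq_zero hA]
      intro k hk
      have := congrFun hc ⟨k, hk⟩
      simp only [LinearMap.coe_mk, AddHom.coe_mk, Pi.zero_apply] at this
      rw [iteratedDeriv_fun_sum]
      · rw [← this]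
        refine Finset.sum_congr rfl fun i _ => ?_
        rw [iteratedDeriv_const_mul_field]
      · intro i _
        exact (analyticAt_const.mul (ha i)).contDiffAt
    have hord2 : ((n : ℤ) : WithTop ℤ) ≤ meromorphicOrderAt (fun z => ∑ i, c i * h i z) p := by
      rw [hA.meromorphicOrderAt_eq]
      generalize analyticOrderAt (fun z => ∑ i, c i * h i z) p = t at hord
      induction t using ENat.recTopCoe with
      | top => simp
      | coe t => 
        have : n ≤ t := by exact_mod_cast hord
        simp only [ENat.map_natCast]
        exact_mod_cast this
    have heq : (fun z => (z - p) ^ n * ∑ i, c i * φ i z) =ᶠ[𝓝[≠] p] (fun z => ∑ i, c i * h i z) := by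
      filter_upwards [eventually_all.2 he] with z hz
      rw [Finset.mul_sum]
      refine Finset.sum_congr rfl fun i _ => ?_
      rw [← hz i]; ring
    have m1 : MeromorphicAt (fun z => (z - p) ^ n) p := by fun_prop
    have m2 : MeromorphicAt (fun z => ∑ i, c i * φ i z) p := by
      apply MeromorphicAt.fun_sum
      intro i _
      exact (MeromorphicAt.const _ _).mul (hm i)
    rw [← meromorphicOrderAt_congr heq, fun_meromorphicOrderAt_mul m1 m2,
      fun_meromorphicOrderAt_pow_id_sub_const] at hord2
    generalize meromorphicOrderAt (fun z => ∑ i, c i * φ i z) p = t at hord2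
    induction t using WithTop.recTopCoe with
    | top => simp
    | coe t =>
      have : (n:ℤ) ≤ n + t := by exact_mod_cast hord2
      have : 0 ≤ t := by linarith
      exact_mod_cast this

theorem ell_reduce (ω₁ ω₂ : ℂ) (hω : LinearIndependent ℝ ![ω₁, ω₂]) :
    ∃ D : Set ℂ, IsCompact D ∧ ∀ z : ℂ, ∃ m n : ℤ, z + m * ω₁ + n * ω₂ ∈ D := by
  refine ⟨(fun q : ℝ × ℝ => (q.1 : ℂ) * ω₁ + q.2 * ω₂) '' (Set.Icc 0 1 ×ˢ Set.Icc 0 1), ?_, ?_⟩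
  · apply (isCompact_Icc.prod isCompact_Icc).image
    fun_prop
  · intro z
    have hs : z ∈ Submodule.span ℝ (Set.range ![ω₁, ω₂]) := by
      rw [hω.span_eq_top_of_card_eq_finrank (by simp [Complex.finrank_real_complex])]
      trivial
    simp only [Matrix.range_cons, Matrix.range_empty, Set.union_empty, Set.singleton_union] at hs
    obtain ⟨s, t, hst⟩ := Submodule.mem_span_pair.1 hs
    refine ⟨-⌊s⌋, -⌊t⌋, ⟨(Int.fract s, Int.fract t), ?_, ?_⟩⟩
    · exact ⟨⟨Int.fract_nonneg _, (Int.fract_lt_one _).le⟩, ⟨Int.fract_nonneg _, (Int.fract_lt_one _).le⟩⟩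
    · simp only [← hst, Int.fract, Complex.real_smul]
      push_cast
      ring

theorem ell_per {ω₁ ω₂ : ℂ} {f : ℂ → ℂ}
    (hf₁ : ∀ z : ℂ, f (z + ω₁) = f z) (hf₂ : ∀ z : ℂ, f (z + ω₂) = f z) (m n : ℤ) (z : ℂ) :
    f (z + m * ω₁ + n * ω₂) = f z := by
  have h1 : Function.Periodic f ω₁ := hf₁
  have h2 : Function.Periodic f ω₂ := hf₂
  rw [h2.int_mul n, h1.int_mul m]

theorem ell_liouville (ω₁ ω₂ : ℂ) (hω : LinearIndependent ℝ ![ω₁, ω₂])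
    (g : ℂ → ℂ) (hg : MeromorphicOn g Set.univ)
    (hf₁ : ∀ z : ℂ, g (z + ω₁) = g z) (hf₂ : ∀ z : ℂ, g (z + ω₂) = g z)
    (ho : ∀ z, 0 ≤ meromorphicOrderAt g z) :
    ∃ C, ∀ z, ContinuousAt g z → g z = C := by
  set G := toMeromorphicNFOn g Set.univ with hG
  have hGa : ∀ z, AnalyticAt ℂ G z := by
    intro z
    rw [← (meromorphicNFOn_toMeromorphicNFOn g Set.univ (Set.mem_univ z)).meromorphicOrderAt_nonneg_iff_analyticAt,
      meromorphicOrderAt_toMeromorphicNFOn hg trivial]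
    exact ho z
  have hGe : ∀ z, g =ᶠ[𝓝[≠] z] G := fun z =>
    (hg.toMeromorphicNFOn_eq_self_on_nhdsNE (Set.mem_univ z)).symm
  have hper : ∀ ω, (∀ z, g (z + ω) = g z) → ∀ z, G (z + ω) = G z := by
    intro ω hω z
    have ht : Tendsto (fun x => x + ω) (𝓝[≠] z) (𝓝[≠] (z + ω)) := by
      apply tendsto_nhdsWithin_of_tendsto_nhds_of_eventually_within
      · exact ((continuous_id.add continuous_const).tendsto z).mono_left nhdsWithin_le_nhds
      · filter_upwards [self_mem_nhdsWithin] with x hx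
        simpa using hx
    have t1 : Tendsto (fun x => G (x + ω)) (𝓝[≠] z) (𝓝 (G (z + ω))) :=
      ((hGa (z + ω)).continuousAt.tendsto.mono_left nhdsWithin_le_nhds).comp ht
    have t2 : Tendsto G (𝓝[≠] z) (𝓝 (G z)) :=
      ((hGa z).continuousAt.tendsto.mono_left nhdsWithin_le_nhds)
    refine tendsto_nhds_unique t1 (t2.congr' ?_)
    filter_upwards [hGe z, ht.eventually (hGe (z + ω))] with x h1 h2
    rw [← h1, ← h2, hω]
  have hGd : Differentiable ℂ G := fun z => (hGa z).differentiableAt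
  obtain ⟨D, hD, hDr⟩ := ell_reduce ω₁ ω₂ hω
  have hb : Bornology.IsBounded (Set.range G) := by
    refine (hD.image hGd.continuous).isBounded.subset ?_
    rintro _ ⟨z, rfl⟩
    obtain ⟨m, n, h⟩ := hDr z
    exact ⟨_, h, ell_per (hper _ hf₁) (hper _ hf₂) m n z⟩
  refine ⟨G 0, fun z hz => ?_⟩
  rw [hGd.apply_eq_apply_of_bounded hb 0 z]
  have t1 : Tendsto g (𝓝[≠] z) (𝓝 (g z)) := hz.tendsto.mono_left nhdsWithin_le_nhds
  have t2 : Tendsto G (𝓝[≠] z) (𝓝 (G z)) :=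
      ((hGa z).continuousAt.tendsto.mono_left nhdsWithin_le_nhds)
  exact tendsto_nhds_unique t1 (t2.congr' (hGe z).symm)

theorem ell_linalg {L : Type*} [CommRing L] (hL : IsField L) {ι α : Type*} [Fintype α] [DecidableEq α]
    (φ : ι → α → L) (h : ∀ s : α → ι, Matrix.det (Matrix.of fun i j => φ (s i) j) = 0) :
    ∃ c : α → L, c ≠ 0 ∧ ∀ i, ∑ j, c j * φ i j = 0 := by
  let _ : Field L := hL.toField
  by_contra hcon
  push Not at hcon
  have hspan : Submodule.span L (Set.range φ) = ⊤ := by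
    by_contra hne
    obtain ⟨l, hl, hle⟩ := Submodule.exists_le_ker_of_lt_top _ (lt_top_iff_ne_top.2 hne)
    have hrep : ∀ x : α → L, l x = ∑ j, l (Pi.single j 1) * x j := by
      intro x
      conv_lhs => rw [← Finset.univ_sum_single x]
      rw [map_sum]
      refine Finset.sum_congr rfl fun j _ => ?_
      have : Pi.single j (x j) = x j • (Pi.single j (1:L) : α → L) := by
        rw [← Pi.single_smul]; simp
      rw [this, map_smul, smul_eq_mul, mul_comm]
    obtain ⟨i, hi⟩ := hcon (fun j => l (Pi.single j 1)) (by
      intro h0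
      apply hl
      ext x
      simpa using congrFun h0 x)
    apply hi
    rw [← hrep]
    exact hle (Submodule.subset_span ⟨i, rfl⟩)
  obtain ⟨b, hbs, hbspan, hbl⟩ := exists_linearIndependent L (Set.range φ)
  rw [hspan] at hbspan
  let B := Module.Basis.mk hbl (by rw [Subtype.range_coe]; exact hbspan.ge)
  let e : b ≃ α := B.indexEquiv (Pi.basisFun L α)
  have hch : ∀ i : α, ∃ k : ι, φ k = (e.symm i : α → L) := fun i => hbs (e.symm i).2
  choose s hs using hch
  have hli : LinearIndependent L (fun i => φ (s i)) := by
    have := hbl.comp e.symm e.symm.injective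
    have h2 : (fun i => φ (s i)) = Subtype.val ∘ e.symm := funext hs
    rw [h2]
    exact this
  have := (Matrix.linearIndependent_rows_iff_isUnit (A := Matrix.of fun i j => φ (s i) j)).1 hli
  rw [Matrix.isUnit_iff_isUnit_det, h s] at this
  exact not_isUnit_zero this

theorem ell_order_pow (f : ℂ → ℂ) (p : ℂ) (hf : MeromorphicAt f p) (m : ℕ)
    (ho : ((-(m:ℤ) : ℤ) : WithTop ℤ) ≤ meromorphicOrderAt f p) (a : ℕ) :
    ((-((a * m : ℕ):ℤ) : ℤ) : WithTop ℤ) ≤ meromorphicOrderAt (fun z => f z ^ a) p := by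
  induction a with
  | zero =>
    simp only [pow_zero, zero_mul]
    simpa using (analyticAt_const (v := (1:ℂ)) (x := p)).meromorphicOrderAt_nonneg
  | succ a ih =>
    have : (fun z => f z ^ (a+1)) = fun z => f z ^ a * f z := by ext z; rw [pow_succ]
    rw [this, fun_meromorphicOrderAt_mul (hf.fun_pow a) hf]
    calc ((-(((a+1) * m : ℕ):ℤ) : ℤ) : WithTop ℤ)
        = ((-((a * m : ℕ):ℤ) : ℤ) : WithTop ℤ) + ((-(m:ℤ) : ℤ) : WithTop ℤ) := by
          rw [← WithTop.coe_add]; congr 1; push_cast; ring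
      _ ≤ _ := add_le_add ih ho

theorem ell_order_prod (f g : ℂ → ℂ) (p : ℂ) (hf : MeromorphicAt f p) (hg : MeromorphicAt g p)
    (m : ℕ) (hof : ((-(m:ℤ) : ℤ) : WithTop ℤ) ≤ meromorphicOrderAt f p)
    (hog : ((-(m:ℤ) : ℤ) : WithTop ℤ) ≤ meromorphicOrderAt g p) (N a b : ℕ) (ha : a ≤ N)
    (hb : b ≤ N) :
    ((-((2 * N * m : ℕ):ℤ) : ℤ) : WithTop ℤ) ≤
      meromorphicOrderAt (fun z => f z ^ a * g z ^ b) p := by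
  rw [fun_meromorphicOrderAt_mul (hf.fun_pow a) (hg.fun_pow b)]
  refine le_trans ?_ (add_le_add (ell_order_pow f p hf m hof a) (ell_order_pow g p hg m hog b))
  rw [← WithTop.coe_add, WithTop.coe_le_coe]
  push_cast
  have h1 : (a:ℤ) * m ≤ N * m := by gcongr
  have h2 : (b:ℤ) * m ≤ N * m := by gcongr
  linarith

theorem ell_poles (ω₁ ω₂ : ℂ) (hω : LinearIndependent ℝ ![ω₁, ω₂])
    (f : ℂ → ℂ) (hf : MeromorphicOn f Set.univ)
    (hf₁ : ∀ z : ℂ, f (z + ω₁) = f z) (hf₂ : ∀ z : ℂ, f (z + ω₂) = f z) :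
    ∃ (P : Finset ℂ) (m : ℕ), (∀ z, ((-(m:ℤ) : ℤ) : WithTop ℤ) ≤ meromorphicOrderAt f z) ∧
      ∀ z, meromorphicOrderAt f z < 0 → ∃ k l : ℤ, z + k * ω₁ + l * ω₂ ∈ P := by
  obtain ⟨D, hD, hDr⟩ := ell_reduce ω₁ ω₂ hω
  have hfin : (D ∩ {z | meromorphicOrderAt f z < 0}).Finite := by
    refine hD.induction_on (p := fun S => (S ∩ {z | meromorphicOrderAt f z < 0}).Finite) ?_ ?_ ?_ ?_
    · simp
    · intro s t hst ht
      exact ht.subset (Set.inter_subset_inter_left _ hst)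
    · intro s t hs ht
      rw [Set.union_inter_distrib_right]
      exact hs.union ht
    · intro x _
      have h := (hf x trivial).eventually_analyticAt
      rw [eventually_nhdsWithin_iff] at h
      refine ⟨_, nhdsWithin_le_nhds h, (Set.finite_singleton x).subset ?_⟩
      rintro y ⟨hy, hy2⟩
      by_contra hne
      exact absurd (hy hne).meromorphicOrderAt_nonneg (not_le.2 hy2)
  have hper : ∀ (k l : ℤ) z, meromorphicOrderAt f (z + k * ω₁ + l * ω₂) = meromorphicOrderAt f z := by
    intro k l z
    have h := meromorphicOrderAt_comp_add_const_eq_meromorphicOrderAt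
      (c := k * ω₁ + l * ω₂) (f := f) (x := z)
    rw [← add_assoc] at h
    rw [← h]
    congr 1
    ext x
    simp only [Function.comp]
    rw [← add_assoc, ell_per hf₁ hf₂]
  have hm : ∀ z, ∃ m : ℕ, ((-(m:ℤ) : ℤ) : WithTop ℤ) ≤ meromorphicOrderAt f z := by
    intro z
    generalize meromorphicOrderAt f z = t
    induction t using WithTop.recTopCoe with
    | top => simp
    | coe t => exact ⟨t.natAbs, by rw [WithTop.coe_le_coe]; omega⟩
  choose mz hmz using hm
  refine ⟨hfin.toFinset, hfin.toFinset.sup mz, ?_, ?_⟩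
  · intro z
    by_cases hz : meromorphicOrderAt f z < 0
    · obtain ⟨k, l, hkl⟩ := hDr z
      have hmem : z + k * ω₁ + l * ω₂ ∈ hfin.toFinset := by
        rw [Set.Finite.mem_toFinset]
        exact ⟨hkl, by simpa [hper] using hz⟩
      have := hmz (z + k * ω₁ + l * ω₂)
      rw [hper] at this
      refine le_trans ?_ this
      rw [WithTop.coe_le_coe]
      have := Finset.le_sup (f := mz) hmem
      omega
    · refine le_trans ?_ (not_lt.1 hz)
      generalize hfin.toFinset.sup mz = k
      rw [← WithTop.coe_zero, WithTop.coe_le_coe]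
      omega
  · intro z hz
    obtain ⟨k, l, hkl⟩ := hDr z
    refine ⟨k, l, ?_⟩
    rw [Set.Finite.mem_toFinset]
    exact ⟨hkl, by simpa [hper] using hz⟩

theorem ell_two_dep (ω₁ ω₂ : ℂ) (hω : LinearIndependent ℝ ![ω₁, ω₂])
    (f : ℂ → ℂ) (hf : MeromorphicOn f Set.univ)
    (hf₁ : ∀ z : ℂ, f (z + ω₁) = f z) (hf₂ : ∀ z : ℂ, f (z + ω₂) = f z) :
    ∃ N : ℕ, ∀ v : ℂ, ∃ c : Fin (N + 1) × Fin (N + 1) → ℂ, c ≠ 0 ∧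
      ∀ u, AnalyticAt ℂ f u → AnalyticAt ℂ f (u + v) →
        ∑ i, c i * (f (u + v) ^ (i.1 : ℕ) * f u ^ (i.2 : ℕ)) = 0 := by
  obtain ⟨P, m, hm, hP⟩ := ell_poles ω₁ ω₂ hω f hf hf₁ hf₂
  refine ⟨4 * P.card * m + 1, fun v => ?_⟩
  generalize hN : 4 * P.card * m + 1 = N
  set g : ℂ → ℂ := fun z => f (z + v) with hg
  have hgm : ∀ z, MeromorphicAt g z := fun z =>
    (hf (z + v) trivial).comp_analyticAt (g := fun z => z + v) (by fun_prop)
  have hfm : ∀ z, MeromorphicAt f z := fun z => hf z trivial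
  have hgo : ∀ z, meromorphicOrderAt g z = meromorphicOrderAt f (z + v) := fun z =>
    meromorphicOrderAt_comp_add_const_eq_meromorphicOrderAt (c := v) (f := f) (x := z)
  let φ : Fin (N + 1) × Fin (N + 1) → ℂ → ℂ := fun i z => g z ^ (i.1 : ℕ) * f z ^ (i.2 : ℕ)
  have hφm : ∀ i z, MeromorphicAt (φ i) z := fun i z => ((hgm z).pow _).mul ((hfm z).pow _)
  have hφo : ∀ i z, ((-((2 * N * m : ℕ):ℤ) : ℤ) : WithTop ℤ) ≤ meromorphicOrderAt (φ i) z := by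
    intro i z
    exact ell_order_prod g f z (hgm z) (hfm z) m (by rw [hgo]; exact hm _) (hm z) N _ _
      (by omega) (by omega)
  choose L hL using fun z => ell_principal φ z (2 * N * m) (fun i => hφm i z) (fun i => hφo i z)
  obtain ⟨z1, hz1, hz1v⟩ : ∃ z1, AnalyticAt ℂ f z1 ∧ AnalyticAt ℂ g z1 :=
    ((hfm 0).eventually_analyticAt.and (hgm 0).eventually_analyticAt).exists
  let pt : P ⊕ P → ℂ := Sum.elim (fun p => p) (fun p => p - v)
  let ev : (Fin (N + 1) × Fin (N + 1) → ℂ) →ₗ[ℂ] ℂ := Fintype.linearCombination ℂ (fun i => φ i z1)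
  let T : (Fin (N + 1) × Fin (N + 1) → ℂ) →ₗ[ℂ] ((P ⊕ P → Fin (2 * N * m) → ℂ) × ℂ) :=
    (LinearMap.pi fun s => L (pt s)).prod ev
  have hker : LinearMap.ker T ≠ ⊥ := by
    apply LinearMap.ker_ne_bot_of_finrank_lt
    simp only [Module.finrank_prod, Module.finrank_pi_fintype, Module.finrank_self,
      Finset.sum_const, Finset.card_univ, Fintype.card_sum, Fintype.card_coe, Fintype.card_fin,
      Fintype.card_prod, smul_eq_mul, mul_one]
    have : (P.card + P.card) * (2 * N * m) = (4 * P.card * m) * N := by ring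
    rw [this]
    have : 4 * P.card * m = N - 1 := by omega
    rw [this]
    have : (N - 1) * N ≤ N * N := by gcongr; omega
    nlinarith
  obtain ⟨c, hc, hc0⟩ := Submodule.exists_mem_ne_zero_of_ne_bot hker
  refine ⟨c, hc0, ?_⟩
  have hc1 : ∀ s, L (pt s) c = 0 := fun s => congrFun (congrArg Prod.fst (LinearMap.mem_ker.1 hc)) s
  have hc2 : ∑ i, c i * φ i z1 = 0 := congrArg Prod.snd (LinearMap.mem_ker.1 hc)
  set G : ℂ → ℂ := fun z => ∑ i, c i * φ i z with hGdef
  have hGm : MeromorphicOn G Set.univ := by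
    intro z _
    apply MeromorphicAt.fun_sum
    intro i _
    exact (MeromorphicAt.const _ _).mul (hφm i z)
  have hg1 : ∀ z, g (z + ω₁) = g z := fun z => by
    simp only [hg]; rw [add_right_comm, hf₁]
  have hg2 : ∀ z, g (z + ω₂) = g z := fun z => by
    simp only [hg]; rw [add_right_comm, hf₂]
  have hG1 : ∀ z, G (z + ω₁) = G z := fun z => by simp only [hGdef, φ, hg1, hf₁]
  have hG2 : ∀ z, G (z + ω₂) = G z := fun z => by simp only [hGdef, φ, hg2, hf₂]
  have hGper : ∀ (k l : ℤ) z, meromorphicOrderAt G (z + k * ω₁ + l * ω₂) = meromorphicOrderAt G z := by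
    intro k l z
    have h := meromorphicOrderAt_comp_add_const_eq_meromorphicOrderAt
      (c := k * ω₁ + l * ω₂) (f := G) (x := z)
    rw [← add_assoc] at h
    rw [← h]
    congr 1
    ext x
    simp only [Function.comp]
    rw [← add_assoc, ell_per hG1 hG2]
  have hGo : ∀ z, 0 ≤ meromorphicOrderAt G z := by
    intro z
    by_cases h1 : meromorphicOrderAt f z < 0
    · obtain ⟨k, l, hkl⟩ := hP z h1
      rw [← hGper k l]
      exact hL _ c (hc1 (Sum.inl ⟨_, hkl⟩))
    by_cases h2 : meromorphicOrderAt f (z + v) < 0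
    · obtain ⟨k, l, hkl⟩ := hP _ h2
      rw [← hGper k l]
      have := hL _ c (hc1 (Sum.inr ⟨_, hkl⟩))
      have e : pt (Sum.inr ⟨_, hkl⟩) = z + k * ω₁ + l * ω₂ := by
        simp only [pt, Sum.elim_inr]; ring
      rwa [e] at this
    · obtain ⟨L0, hL0⟩ := ell_principal φ z 0 (fun i => hφm i z) (fun i => by
        have := ell_order_prod g f z (hgm z) (hfm z) 0 (by rw [hgo]; simpa using h2)
          (by simpa using h1) N i.1 i.2 (by omega) (by omega)
        simpa using this)
      exact hL0 c (Subsingleton.elim _ _)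
  obtain ⟨C, hC⟩ := ell_liouville ω₁ ω₂ hω G hGm hG1 hG2 hGo
  have hcont : ∀ z, AnalyticAt ℂ f z → AnalyticAt ℂ g z → ContinuousAt G z := by
    intro z h1 h2
    have h1 := h1.continuousAt
    have h2 := h2.continuousAt
    simp only [hGdef, φ]
    fun_prop
  have hC0 : C = 0 := by
    rw [← hC z1 (hcont z1 hz1 hz1v)]; exact hc2
  intro u hu huv
  have hgu : AnalyticAt ℂ g u := huv.comp_of_eq (f := fun z => z + v) (by fun_prop) rfl
  have := hC u (hcont u hu hgu)
  rw [hC0] at this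
  exact this

theorem ell_isField {R K : Type*} [CommRing R] [IsDomain R] [Field K] [Algebra R K] :
    IsField (Subalgebra.algebraicClosure R K) where
  exists_pair_ne := ⟨0, 1, zero_ne_one⟩
  mul_comm := mul_comm
  mul_inv_cancel {a} ha := by
    have h : IsAlgebraic R (a : K) := a.2
    refine ⟨⟨(a : K)⁻¹, h.inv⟩, ?_⟩
    apply Subtype.ext
    exact mul_inv_cancel₀ (fun h0 => ha (Subtype.ext h0))

/-- Descend a polynomial relation from the algebraic closure. -/
theorem ell_descend {R S : Type*} [CommRing R] [IsDomain R] [CommRing S] [IsDomain S] [Algebra R S]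
    [Algebra.IsAlgebraic R S] (P : MvPolynomial (Fin 2) S) (hP : P ≠ 0) :
    ∃ Q : MvPolynomial (Fin 2) R, Q ≠ 0 ∧ ∀ x : Fin 2 → S, MvPolynomial.eval x P = 0 →
      MvPolynomial.aeval x Q = 0 := by
  let _ : Algebra (MvPolynomial (Fin 2) R) (MvPolynomial (Fin 2) S) :=
    MvPolynomial.algebraMvPolynomial
  have h := Ideal.comap_ne_bot_of_algebraic_mem (R := MvPolynomial (Fin 2) R)
    (I := Ideal.span {P}) hP (Ideal.subset_span rfl) (Algebra.IsAlgebraic.isAlgebraic P)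
  obtain ⟨Q, hQ, hQ0⟩ := Submodule.exists_mem_ne_zero_of_ne_bot h
  refine ⟨Q, hQ0, fun x hx => ?_⟩
  obtain ⟨A, hA⟩ := Ideal.mem_span_singleton.1 (Ideal.mem_comap.1 hQ)
  rw [MvPolynomial.algebraMap_def] at hA
  have : MvPolynomial.aeval x Q = MvPolynomial.eval x (MvPolynomial.map (algebraMap R S) Q) := by
    rw [MvPolynomial.eval_map]; rfl
  rw [this, hA, map_mul, hx, zero_mul]

theorem ell_poly_ne_zero {S : Type*} [CommRing S] {N : ℕ} (c : Fin (N + 1) × Fin (N + 1) → S)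
    (hc : c ≠ 0) :
    (∑ i, MvPolynomial.C (c i) * (MvPolynomial.X 0 ^ (i.1 : ℕ) * MvPolynomial.X 1 ^ (i.2 : ℕ)) :
      MvPolynomial (Fin 2) S) ≠ 0 := by
  intro h0
  obtain ⟨⟨a, b⟩, hab⟩ := Function.ne_iff.1 hc
  apply hab
  have hmon : ∀ i : Fin (N + 1) × Fin (N + 1),
      (MvPolynomial.C (c i) * (MvPolynomial.X 0 ^ (i.1 : ℕ) * MvPolynomial.X 1 ^ (i.2 : ℕ)) :
        MvPolynomial (Fin 2) S) = MvPolynomial.monomial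
          (Finsupp.single 0 (i.1 : ℕ) + Finsupp.single 1 (i.2 : ℕ)) (c i) := by
    intro i
    rw [MvPolynomial.X_pow_eq_monomial, MvPolynomial.X_pow_eq_monomial,
      MvPolynomial.monomial_mul, MvPolynomial.C_mul_monomial]
    simp
  have := congrArg (MvPolynomial.coeff
    (Finsupp.single 0 (a : ℕ) + Finsupp.single 1 (b : ℕ))) h0
  simp only [hmon, MvPolynomial.coeff_sum, MvPolynomial.coeff_monomial,
    MvPolynomial.coeff_zero] at this
  rw [Finset.sum_eq_single (a, b)] at this
  · simpa using this
  · rintro ⟨a', b'⟩ _ hne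
    refine if_neg fun h => hne ?_
    have h1 := DFunLike.congr_fun h 0
    have h2 := DFunLike.congr_fun h 1
    simp at h1 h2
    rw [Fin.ext h1, Fin.ext h2]
  · simp

theorem ell_mero_eval (Q : MvPolynomial (Fin 3) ℂ) (z : ℂ) {a b d : ℂ → ℂ}
    (ha : MeromorphicAt a z) (hb : MeromorphicAt b z) (hd : MeromorphicAt d z) :
    MeromorphicAt (fun v => MvPolynomial.eval ![a v, b v, d v] Q) z := by
  simp only [MvPolynomial.eval_eq', Fin.prod_univ_three]
  refine MeromorphicAt.fun_sum fun i _ => (MeromorphicAt.const _ _).mul ?_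
  exact ((ha.fun_pow _).mul (hb.fun_pow _)).mul (hd.fun_pow _)

theorem ell_cont_eval (Q : MvPolynomial (Fin 3) ℂ) (z : ℂ) {a b d : ℂ → ℂ}
    (ha : ContinuousAt a z) (hb : ContinuousAt b z) (hd : ContinuousAt d z) :
    ContinuousAt (fun v => MvPolynomial.eval ![a v, b v, d v] Q) z := by
  simp only [MvPolynomial.eval_eq', Fin.prod_univ_three]
  refine tendsto_finsetSum _ fun i _ => tendsto_const_nhds.mul ?_
  exact ((ha.pow _).mul (hb.pow _)).mul (hd.pow _)

set_option maxHeartbeats 1000000 in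
/-- The dependence relation at the heart of the paper's proof, case n = 1:
for an elliptic function f with lattice ℤω₁ + ℤω₂, the three functions
(u, v) ↦ f(u+v), (u, v) ↦ f(u), (u, v) ↦ f(v) on ℂ × ℂ are algebraically
dependent. -/
theorem elliptic_sum_functions_algebraically_dependent
    (ω₁ ω₂ : ℂ) (hω : LinearIndependent ℝ ![ω₁, ω₂])
    (f : ℂ → ℂ) (hf : MeromorphicOn f Set.univ)
    (hf₁ : ∀ z : ℂ, f (z + ω₁) = f z) (hf₂ : ∀ z : ℂ, f (z + ω₂) = f z) :
    ∃ Q : MvPolynomial (Fin 3) ℂ, Q ≠ 0 ∧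
      ∀ p : ℂ × ℂ, AnalyticAt ℂ f p.1 → AnalyticAt ℂ f p.2 →
        AnalyticAt ℂ f (p.1 + p.2) →
        MvPolynomial.eval ![f (p.1 + p.2), f p.1, f p.2] Q = 0 := by
  obtain ⟨N, hN⟩ := ell_two_dep ω₁ ω₂ hω f hf hf₁ hf₂
  let V : Ultrafilter ℂ := Ultrafilter.of (𝓝[≠] 0)
  have hV : (V : Filter ℂ) ≤ 𝓝[≠] 0 := Ultrafilter.of_le _
  have hfu : ∀ u, Meromorphic (fun v => f (u + v)) := fun u v =>
    (hf (u + v) trivial).comp_analyticAt (g := fun v => u + v) (by fun_prop)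
  have hgood : ∀ u, ∀ᶠ v in (V : Filter ℂ), AnalyticAt ℂ f (u + v) := by
    intro u
    filter_upwards [hV ((hfu u 0).eventually_analyticAt)] with v hv
    have := AnalyticAt.comp_of_eq (g := fun v => f (u + v)) (f := fun w => w - u) (x := u + v)
      (by simpa using hv) (by fun_prop) (by ring)
    simpa [Function.comp_def] using this
  have hgood0 : ∀ᶠ v in (V : Filter ℂ), AnalyticAt ℂ f v := by simpa using hgood 0
  -- identity principle along the ultrafilter
  have hid : ∀ g : ℂ → ℂ, MeromorphicOn g Set.univ → (∀ᶠ v in (V : Filter ℂ), g v = 0) →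
      ∀ w, ContinuousAt g w → g w = 0 := by
    intro g hg h w hw
    exact ell_ident g hg 0 (h.frequently.filter_mono hV) w hw
  let K := (V : Filter ℂ).Germ ℂ
  let θ : (ℂ → ℂ) →+* K := Filter.Germ.coeRingHom (V : Filter ℂ)
  have hθ : ∀ a b : ℂ → ℂ, θ a = θ b ↔ ∀ᶠ v in (V : Filter ℂ), a v = b v := fun a b =>
    Filter.Germ.coe_eq
  let ρ : Polynomial ℂ →+* (ℂ → ℂ) := RingHom.pi fun v => Polynomial.evalRingHom (f v)
  have hρ : ∀ p v, ρ p v = p.eval (f v) := fun _ _ => rfl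
  by_cases hinj : ∃ p : Polynomial ℂ, p ≠ 0 ∧ θ (ρ p) = 0
  · obtain ⟨p, hp, hp0⟩ := hinj
    refine ⟨Polynomial.aeval (MvPolynomial.X 2) p, ?_, ?_⟩
    · intro h0
      have := (MvPolynomial.transcendental_X ℂ (2 : Fin 3))
      exact this ⟨p, hp, h0⟩
    · rintro ⟨u, v⟩ hu hv huv
      rw [← map_zero θ, hθ] at hp0
      have := hid (fun v => p.eval (f v)) ?_ hp0 v ?_
      · have e : MvPolynomial.eval ![f (u + v), f u, f v] (Polynomial.aeval (MvPolynomial.X 2) p)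
            = p.eval (f v) := by
          rw [Polynomial.aeval_def, Polynomial.hom_eval₂]
          have hc : (MvPolynomial.eval ![f (u + v), f u, f v]).comp
              (algebraMap ℂ (MvPolynomial (Fin 3) ℂ)) = RingHom.id ℂ := by
            ext a; simp [MvPolynomial.algebraMap_eq]
          rw [hc, MvPolynomial.eval_X]
          rfl
        rw [e]; exact this
      · intro z _
        simp only [Polynomial.eval_eq_sum_range]
        exact MeromorphicAt.fun_sum fun i _ =>
          (MeromorphicAt.const _ _).mul ((hf z trivial).fun_pow i)
      · have := hv.continuousAt
        exact p.continuous.continuousAt.comp this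
  push Not at hinj
  let _ : Algebra (Polynomial ℂ) K := (θ.comp ρ).toAlgebra
  have hmap : ∀ p, algebraMap (Polynomial ℂ) K p = θ (ρ p) := fun _ => rfl
  let S := Subalgebra.algebraicClosure (Polynomial ℂ) K
  -- translates are algebraic
  have hy : ∀ u, IsAlgebraic (Polynomial ℂ) (θ fun v => f (u + v)) := by
    intro u
    obtain ⟨c, hc, hcu⟩ := hN u
    refine ⟨∑ i, Polynomial.C (Polynomial.C (c i) * Polynomial.X ^ (i.2 : ℕ)) * Polynomial.X ^ (i.1 : ℕ), ?_, ?_⟩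
    · obtain ⟨⟨a, b⟩, hab⟩ := Function.ne_iff.1 hc
      intro h0
      apply hab
      have := congrArg (fun q => (Polynomial.coeff q a).coeff b) h0
      simp only [Polynomial.C_mul_X_pow_eq_monomial, Polynomial.finsetSum_coeff,
        Polynomial.coeff_monomial, Polynomial.coeff_zero] at this
      rw [Finset.sum_eq_single (a, b)] at this
      · simpa using this
      · rintro ⟨a', b'⟩ _ hne
        by_cases h1 : (a' : ℕ) = a
        · have h2 : (b' : ℕ) ≠ b := fun h2 => hne (by rw [Fin.ext h1, Fin.ext h2])
          simp [h1, h2, Polynomial.coeff_monomial]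
        · simp [h1]
      · simp
    · have : θ (fun v => ∑ i, c i * (f (v + u) ^ (i.1 : ℕ) * f v ^ (i.2 : ℕ))) = 0 := by
        rw [← map_zero θ, hθ]
        filter_upwards [hgood u, hgood0] with v h1 h2
        exact hcu v h2 (by rwa [add_comm])
      rw [← this]
      simp only [map_sum, map_mul, map_pow, Polynomial.aeval_C, Polynomial.aeval_X, hmap]
      simp only [← map_pow, ← map_mul, ← map_sum]
      congr 1
      ext v
      simp only [Finset.sum_apply, Pi.mul_apply, Pi.pow_apply, hρ, Polynomial.eval_mul,
        Polynomial.eval_pow, Polynomial.eval_C, Polynomial.eval_X, add_comm u v]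
      refine Finset.sum_congr rfl fun i _ => ?_
      ring
  have hconst : ∀ a : ℂ, IsAlgebraic (Polynomial ℂ) (θ fun _ => a) := by
    intro a
    have : θ (fun _ => a) = algebraMap (Polynomial ℂ) K (Polynomial.C a) := by
      rw [hmap]; congr 1; ext v; simp [hρ]
    rw [this]
    exact isAlgebraic_algebraMap _
  let y : ℂ → S := fun u => ⟨θ fun v => f (u + v), hy u⟩
  let k : ℂ → S := fun a => ⟨θ fun _ => a, hconst a⟩
  let φ : {u // AnalyticAt ℂ f u} → Fin (N + 1) × Fin (N + 1) → S := fun u i =>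
    y u ^ (i.1 : ℕ) * k (f u) ^ (i.2 : ℕ)
  obtain ⟨c, hc0, hc⟩ := ell_linalg (L := S) ell_isField φ (by
    intro s
    apply Subtype.val_injective
    have e1 := (algebraMap S K).map_det (Matrix.of fun i j => φ (s i) j)
    have e2 := θ.map_det (Matrix.of fun i j v => f (s i + v) ^ (j.1 : ℕ) * f (s i) ^ (j.2 : ℕ))
    have e3 : (algebraMap S K).mapMatrix (Matrix.of fun i j => φ (s i) j) = 
      θ.mapMatrix (Matrix.of fun i j v => f (s i + v) ^ (j.1 : ℕ) * f (s i) ^ (j.2 : ℕ)) := by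
      ext i j
      rfl
    change algebraMap S K _ = 0
    rw [e1, e3, ← e2, ← map_zero θ, hθ]
    filter_upwards [eventually_all.2 fun i => hgood (s i)] with v hv
    have e4 := (Pi.evalRingHom (fun _ : ℂ => ℂ) v).map_det
      (Matrix.of fun i j v => f (s i + v) ^ (j.1 : ℕ) * f (s i) ^ (j.2 : ℕ))
    refine e4.trans ?_
    obtain ⟨c, hc, hcu⟩ := hN v
    change _ = (0:ℂ)
    rw [← Matrix.exists_mulVec_eq_zero_iff]
    refine ⟨c, hc, ?_⟩
    ext i
    refine Eq.trans ?_ (hcu (s i) (s i).2 (hv i))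
    simp [Matrix.mulVec, dotProduct, mul_comm])
  obtain ⟨Q, hQ0, hQ⟩ := ell_descend (R := Polynomial ℂ)
    (∑ i, MvPolynomial.C (c i) * (MvPolynomial.X 0 ^ (i.1 : ℕ) * MvPolynomial.X 1 ^ (i.2 : ℕ)) :
      MvPolynomial (Fin 2) S) (ell_poly_ne_zero c hc0)
  have hQ2 : ∀ u, AnalyticAt ℂ f u → ∀ᶠ v in (V : Filter ℂ),
      MvPolynomial.eval₂ (Polynomial.evalRingHom (f v)) ![f (u + v), f u] Q = 0 := by
    intro u hu
    have h1 := hQ ![y u, k (f u)] (by simpa using hc ⟨u, hu⟩)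
    have h2 : θ (fun v => MvPolynomial.eval₂ (Polynomial.evalRingHom (f v)) ![f (u + v), f u] Q) = 0 := by
      have h3 := congrArg (algebraMap S K) h1
      rw [map_zero] at h3
      rw [← h3]
      have h4 : θ.comp (RingHom.pi fun v =>
          MvPolynomial.eval₂Hom (Polynomial.evalRingHom (f v)) ![f (u + v), f u]) =
          (algebraMap S K).comp (MvPolynomial.aeval (R := Polynomial ℂ) ![y u, k (f u)]).toRingHom := by
        apply MvPolynomial.ringHom_ext
        · intro r
          have : (MvPolynomial.aeval (R := Polynomial ℂ) ![y u, k (f u)]).toRingHom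
            (MvPolynomial.C r) = algebraMap _ S r := MvPolynomial.aeval_C _ _
          rw [RingHom.comp_apply, RingHom.comp_apply, this]
          change _ = θ (ρ r)
          congr 1
          ext v
          simp [hρ]
        · intro i
          have : (MvPolynomial.aeval (R := Polynomial ℂ) ![y u, k (f u)]).toRingHom
            (MvPolynomial.X i) = ![y u, k (f u)] i := MvPolynomial.aeval_X _ _
          rw [RingHom.comp_apply, RingHom.comp_apply, this]
          fin_cases i
          · change _ = θ (fun v => f (u + v))
            congr 1
            ext v
            simp
          · change _ = θ (fun v => f u)
            congr 1
            ext v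
            simp
      exact congrArg (fun h : MvPolynomial (Fin 2) (Polynomial ℂ) →+* K => h Q) h4
    rwa [← map_zero θ, hθ] at h2
  let e : Option (Fin 2) ≃ Fin 3 := (finSuccEquivLast (n := 2)).symm
  refine ⟨MvPolynomial.rename e ((MvPolynomial.optionEquivRight ℂ (Fin 2)).symm Q), ?_, ?_⟩
  · intro h0
    apply hQ0
    have := MvPolynomial.rename_injective _ e.injective (h0.trans (map_zero _).symm)
    exact (map_eq_zero_iff _ (MvPolynomial.optionEquivRight ℂ (Fin 2)).symm.injective).1 this
  · have hev : ∀ a b d : ℂ, MvPolynomial.eval ![a, b, d] (MvPolynomial.rename e ((MvPolynomial.optionEquivRight ℂ (Fin 2)).symm Q)) = MvPolynomial.eval₂ (Polynomial.evalRingHom d) ![a, b] Q := by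
      intro a b d
      obtain ⟨Q'', rfl⟩ := (MvPolynomial.optionEquivRight ℂ (Fin 2)).surjective Q
      rw [AlgEquiv.symm_apply_apply]
      have h4 : (MvPolynomial.eval ![a, b, d]).comp
          ((MvPolynomial.rename (R := ℂ) e).toRingHom) =
          (MvPolynomial.eval₂Hom (Polynomial.evalRingHom d) ![a, b]).comp
            ((MvPolynomial.optionEquivRight ℂ (Fin 2)).toAlgHom.toRingHom) := by
        apply MvPolynomial.ringHom_ext
        · intro r
          simp
        · rintro (_ | i)
          · simp [e]
          · fin_cases i
            · simp [e]
            · simp [e]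
      exact congrArg (fun h : MvPolynomial (Option (Fin 2)) ℂ →+* ℂ => h Q'') h4
    rintro ⟨u, v⟩ hu hv huv
    generalize MvPolynomial.rename e ((MvPolynomial.optionEquivRight ℂ (Fin 2)).symm Q) = Q' at hev
    refine hid (fun v => MvPolynomial.eval ![f (u + v), f u, f v] Q') ?_ ?_ v ?_
    · intro z _
      exact ell_mero_eval Q' z (hfu u z) (MeromorphicAt.const _ _) (hf z trivial)
    · filter_upwards [hQ2 u hu] with v hv
      rw [hev, hv]
    · have h1 : ContinuousAt (fun v => f (u + v)) v :=
        ContinuousAt.comp (g := f) huv.continuousAt (by fun_prop)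
      have h2 := hv.continuousAt
      exact ell_cont_eval Q' v h1 continuousAt_const h2
end
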